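/- arXiv:2306.07100 — 2 statements merged into one kernel-verified Lean document; each statement's English description precedes it below -/
import Mathlib

section
/- Cones of finite Morse index are stable away from the vertex: let n ≥ 1, s ∈ (0,1), and let E ⊆ ℝ^n be a cone with Per_s(E;B₁(0)) < ∞ which is an s-minimal surface in ℝ^n. Assume E satisfies the following almost-stability property for some m ∈ ℕ and C₁ > 0: for every collection X₁,…,X_{m+1} of smooth vector fields on ℝ^n with pairwise disjoint compact supports A₁,…,A_{m+1} and every choice of weights λ_{iℓ} > 0 (1 ≤ i < ℓ ≤ m+1), there exists an index i such that for every bounded open Ω ⊇ A_i the map t ↦ Per_s(ψ_{X_i}^t(E);Ω) has second derivative at t = 0 at least -C₁·‖X_i‖_{L^∞}²·diam(A_i)^{2(n-1)}·(Σ_{ℓ<i} λ_{ℓi}^{-1}·D_{iℓ}^{-(n+s)} + Σ_{ℓ>i} λ_{iℓ}·D_{iℓ}^{-(n+s)}), where D_{iℓ} := dist(A_i,A_ℓ). Then E is stable in ℝ^n∖{0}: for every smooth vector field X compactly supported in a bounded open Ω with closure contained in ℝ^n∖{0}, the map t ↦ Per_s(ψ_X^t(E);Ω) has second derivative ≥ 0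 at t = 0. -/
open MeasureTheory Real Set Metric Filter Topology Pointwise
open scoped ENNReal RealInnerProductSpace

noncomputable section

/-- Euclidean `n`-space. -/
abbrev Rn (n : ℕ) : Type := EuclideanSpace ℝ (Fin n)

/-- The normalizing constant `α_{n,s}` of the fractional Laplacian kernel. -/
def alphaC (n : ℕ) (s : ℝ) : ℝ :=
  s * 2 ^ (s - 1) * Real.Gamma (((n : ℝ) + s) / 2) /
    (Real.pi ^ ((n : ℝ) / 2) * Real.Gamma (1 - s / 2))

/-- The fractional kernel `α_{n,s} |x-y|^{-(n+s)}`. -/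
def fracKer (n : ℕ) (s : ℝ) (x y : Rn n) : ℝ :=
  alphaC n s * ‖x - y‖ ^ (-((n : ℝ) + s))

/-- Real-valued characteristic function of a set. -/
def chi {α : Type*} (E : Set α) : α → ℝ := E.indicator 1

/-- The relative fractional `s`-perimeter `Per_s(E;Ω)`, as an extended real. -/
def fracPer (n : ℕ) (s : ℝ) (E Ω : Set (Rn n)) : ℝ≥0∞ :=
  ∫⁻ p in ((Ωᶜ ×ˢ Ωᶜ)ᶜ : Set (Rn n × Rn n)),
    ENNReal.ofReal ((chi E p.1 - chi E p.2) ^ 2 * fracKer n s p.1 p.2)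

/-- `ψ` is the flow of the vector field `X`. -/
def IsFlowOf {n : ℕ} (X : Rn n → Rn n) (ψ : ℝ → Rn n → Rn n) : Prop :=
  (∀ x, ψ 0 x = x) ∧ ∀ x t, HasDerivAt (fun τ => ψ τ x) (X (ψ t x)) t

/-- `E` is an `s`-minimal surface in the open set `U ⊆ ℝ^n`. -/
def IsSMinimalOn (n : ℕ) (s : ℝ) (E U : Set (Rn n)) : Prop :=
  ∀ Ω : Set (Rn n), IsOpen Ω → Bornology.IsBounded Ω → closure Ω ⊆ U →
    fracPer n s E Ω < ⊤ ∧
    ∀ X : Rn n → Rn n, ContDiff ℝ (⊤ : ℕ∞) X → HasCompactSupport X → tsupport X ⊆ Ω →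
      ∀ ψ : ℝ → Rn n → Rn n, IsFlowOf X ψ →
        HasDerivAt (fun t => (fracPer n s ((ψ t) '' E) Ω).toReal) 0 0

/-- `E` is stable (nonnegative second variation of `Per_s`) in the open set `U`. -/
def IsStableIn (n : ℕ) (s : ℝ) (E U : Set (Rn n)) : Prop :=
  ∀ Ω : Set (Rn n), IsOpen Ω → Bornology.IsBounded Ω → closure Ω ⊆ U →
    ∀ X : Rn n → Rn n, ContDiff ℝ (⊤ : ℕ∞) X → HasCompactSupport X → tsupport X ⊆ Ω →
      ∀ ψ : ℝ → Rn n → Rn n, IsFlowOf X ψ →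
        0 ≤ iteratedDeriv 2 (fun t => (fracPer n s ((ψ t) '' E) Ω).toReal) 0

/-- A cone: an open set invariant under all positive dilations. -/
def IsCone (n : ℕ) (E : Set (Rn n)) : Prop :=
  IsOpen E ∧ ∀ l : ℝ, 0 < l → l • E = E

/-- `∂E ∖ {0}` is a smooth embedded hypersurface: near each of its points, `E` is a smooth
sublevel set with nonvanishing gradient. -/
def SmoothAwayFromOrigin (n : ℕ) (E : Set (Rn n)) : Prop :=
  ∀ x ∈ frontier E \ {0}, ∃ (U : Set (Rn n)) (f : Rn n → ℝ),
    IsOpen U ∧ x ∈ U ∧ ContDiff ℝ (⊤ : ℕ∞) f ∧ (∀ y ∈ U, fderiv ℝ f y ≠ 0) ∧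
      E ∩ U = {y | f y < 0} ∩ U

/-- `n < n_s^*`: for every `3 ≤ k ≤ n`, every smooth stable `s`-minimal cone in
`ℝ^k ∖ {0}` is a half-space. -/
def BelowCriticalDim (n : ℕ) (s : ℝ) : Prop :=
  ∀ k : ℕ, 3 ≤ k → k ≤ n → ∀ E : Set (Rn k),
    IsCone k E → SmoothAwayFromOrigin k E →
    IsSMinimalOn k s E ({0}ᶜ) → IsStableIn k s E ({0}ᶜ) →
    ∃ e : Rn k, ‖e‖ = 1 ∧ E = {x | 0 < ⟪e, x⟫}

/-- Distance between two subsets of a metric space. -/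
def setDist {α : Type*} [PseudoMetricSpace α] (A B : Set α) : ℝ :=
  sInf (Set.image2 dist A B)

/-- Sup norm of a vector field. -/
def supNorm {n : ℕ} (X : Rn n → Rn n) : ℝ := ⨆ x, ‖X x‖

/-- Almost-stability in one out of `m+1` disjoint sets, with the quantitative lower bound of
the paper for the second variation of the fractional perimeter. -/
def AlmostStableProperty (n : ℕ) (s : ℝ) (m : ℕ) (C₁ : ℝ) (E : Set (Rn n)) : Prop :=
  ∀ X : Fin (m + 1) → Rn n → Rn n,
    (∀ i, ContDiff ℝ (⊤ : ℕ∞) (X i)) → (∀ i, HasCompactSupport (X i)) →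
    (∀ i j, i ≠ j → Disjoint (tsupport (X i)) (tsupport (X j))) →
    ∀ lam : Fin (m + 1) → Fin (m + 1) → ℝ, (∀ i j, i < j → 0 < lam i j) →
    ∃ i : Fin (m + 1),
      ∀ Ω : Set (Rn n), IsOpen Ω → Bornology.IsBounded Ω → tsupport (X i) ⊆ Ω →
      ∀ ψ : ℝ → Rn n → Rn n, IsFlowOf (X i) ψ →
        -(C₁ * supNorm (X i) ^ 2 * Metric.diam (tsupport (X i)) ^ (2 * (n - 1)) *
            ((∑ l ∈ Finset.univ.filter (fun l => l < i),
                (lam l i)⁻¹ * setDist (tsupport (X i)) (tsupport (X l)) ^ (-((n : ℝ) + s))) +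
             (∑ l ∈ Finset.univ.filter (fun l => i < l),
                lam i l * setDist (tsupport (X i)) (tsupport (X l)) ^ (-((n : ℝ) + s)))))
          ≤ iteratedDeriv 2 (fun t => (fracPer n s ((ψ t) '' E) Ω).toReal) 0

end

noncomputable section

section Scaling

variable {n : ℕ} {R : ℝ}

theorem IsCone.inv_smul_mem_iff {E : Set (Rn n)} (hE : IsCone n E) (hR : 0 < R) (x : Rn n) :
    R⁻¹ • x ∈ E ↔ x ∈ E := by
  conv_rhs => rw [← hE.2 R hR]
  exact (mem_smul_set_iff_inv_smul_mem₀ hR.ne' E x).symm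

theorem chi_smul_set (hR : 0 < R) (F : Set (Rn n)) (x : Rn n) :
    chi (R • F) (R • x) = chi F x := by
  have h : R • x ∈ R • F ↔ x ∈ F := smul_mem_smul_set_iff₀ hR.ne' F x
  by_cases hx : x ∈ F
  · simp [chi, hx, h.2 hx]
  · simp [chi, hx, mt h.1 hx]

theorem fracKer_smul (hR : 0 < R) (s : ℝ) (x y : Rn n) :
    fracKer n s (R • x) (R • y) = R ^ (-((n : ℝ) + s)) * fracKer n s x y := by
  unfold fracKer
  rw [← smul_sub, norm_smul, Real.norm_of_nonneg hR.le,
    Real.mul_rpow hR.le (norm_nonneg _)]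
  ring

theorem volume_eq_smul_map_smul_prod (hR : 0 < R) :
    (volume : Measure (Rn n × Rn n)) =
      ENNReal.ofReal (R ^ (2 * n)) • Measure.map (R • ·) volume := by
  have : (volume : Measure (Rn n × Rn n)).IsAddHaarMeasure :=
    Measure.prod.instIsAddHaarMeasure _ _
  have hfin : Module.finrank ℝ (Rn n × Rn n) = 2 * n := by
    simp [two_mul]
  rw [Measure.map_addHaar_smul _ hR.ne', hfin, smul_smul, ← ENNReal.ofReal_mul (by positivity),
    abs_of_pos (by positivity), mul_inv_cancel₀ (by positivity), ENNReal.ofReal_one, one_smul]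

/-- The relative fractional perimeter is homogeneous under dilations. -/
theorem fracPer_smul (hR : 0 < R) (s : ℝ) (F Ω : Set (Rn n)) :
    fracPer n s (R • F) (R • Ω) =
      ENNReal.ofReal (R ^ (2 * n) * R ^ (-((n : ℝ) + s))) * fracPer n s F Ω := by
  have hemb : MeasurableEmbedding (fun p : Rn n × Rn n => R • p) :=
    (Homeomorph.smulOfNeZero R hR.ne').measurableEmbedding
  have hpre : (fun p : Rn n × Rn n => R • p) ⁻¹' (((R • Ω)ᶜ ×ˢ (R • Ω)ᶜ)ᶜ) =
      (Ωᶜ ×ˢ Ωᶜ)ᶜ := by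
    ext p
    simp only [mem_preimage, mem_compl_iff, mem_prod, Prod.smul_fst, Prod.smul_snd,
      smul_mem_smul_set_iff₀ hR.ne']
  unfold fracPer
  conv_lhs => rw [volume_eq_smul_map_smul_prod hR]
  rw [Measure.restrict_smul, lintegral_smul_measure, hemb.restrict_map, hemb.lintegral_map, hpre,
    smul_eq_mul, ENNReal.ofReal_mul (by positivity), mul_assoc]
  congr 1
  rw [← lintegral_const_mul' _ _ ENNReal.ofReal_ne_top]
  congr 1 with p
  rw [Prod.smul_fst, Prod.smul_snd, chi_smul_set hR, chi_smul_set hR, fracKer_smul hR,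
    ← ENNReal.ofReal_mul (by positivity)]
  congr 1
  ring

/-- The conjugate of the vector field `X` by the dilation of factor `R`. -/
def dilateField (R : ℝ) (X : Rn n → Rn n) : Rn n → Rn n := fun x => R • X (R⁻¹ • x)

theorem ContDiff.dilateField {X : Rn n → Rn n} (hX : ContDiff ℝ (⊤ : ℕ∞) X) :
    ContDiff ℝ (⊤ : ℕ∞) (dilateField R X) :=
  (hX.comp (contDiff_const_smul R⁻¹)).const_smul R

theorem tsupport_dilateField (hR : 0 < R) (X : Rn n → Rn n) :
    tsupport (dilateField R X) = R • tsupport X := by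
  rw [tsupport, tsupport, ← closure_smul₀' hR.ne']
  congr 1
  ext x
  simp [mem_smul_set_iff_inv_smul_mem₀ hR.ne', dilateField, hR.ne']

theorem HasCompactSupport.dilateField (hR : 0 < R) {X : Rn n → Rn n}
    (hX : HasCompactSupport X) : HasCompactSupport (dilateField R X) := by
  rw [HasCompactSupport, tsupport_dilateField hR]
  exact IsCompact.smul R hX

theorem supNorm_dilateField (hR : 0 < R) (X : Rn n → Rn n) :
    supNorm (dilateField R X) = R * supNorm X := by
  unfold supNorm dilateField
  simp only [norm_smul, Real.norm_of_nonneg hR.le]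
  rw [← Real.mul_iSup_of_nonneg hR.le]
  congr 1
  exact (Homeomorph.smulOfNeZero R⁻¹ (inv_ne_zero hR.ne')).surjective.iSup_comp
    (g := fun y => ‖X y‖)

theorem IsFlowOf.dilateField (hR : 0 < R) {X : Rn n → Rn n} {ψ : ℝ → Rn n → Rn n}
    (hψ : IsFlowOf X ψ) : IsFlowOf (dilateField R X) (fun t x => R • ψ t (R⁻¹ • x)) := by
  refine ⟨fun x => by simp [hψ.1, hR.ne'], fun x t => ?_⟩
  have h : _root_.dilateField R X (R • ψ t (R⁻¹ • x)) = R • X (ψ t (R⁻¹ • x)) := by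
    simp [_root_.dilateField, hR.ne']
  rw [h]
  exact (hψ.2 (R⁻¹ • x) t).const_smul R

theorem IsCone.image_dilate {E : Set (Rn n)} (hE : IsCone n E) (hR : 0 < R)
    (φ : Rn n → Rn n) : (fun x => R • φ (R⁻¹ • x)) '' E = R • (φ '' E) := by
  rw [← image_smul, image_image]
  ext y
  constructor
  · rintro ⟨x, hx, rfl⟩
    exact ⟨R⁻¹ • x, (hE.inv_smul_mem_iff hR x).2 hx, rfl⟩
  · rintro ⟨x, hx, rfl⟩
    exact ⟨R • x, (hE.inv_smul_mem_iff hR _).1 (by simpa [hR.ne'] using hx), by simp [hR.ne']⟩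

theorem IsCone.iteratedDeriv_fracPer_dilate {E : Set (Rn n)} (hE : IsCone n E) (hR : 0 < R)
    (s : ℝ) (Ω : Set (Rn n)) (ψ : ℝ → Rn n → Rn n) :
    iteratedDeriv 2
        (fun t => (fracPer n s ((fun x => R • ψ t (R⁻¹ • x)) '' E) (R • Ω)).toReal) 0 =
      R ^ (2 * n) * R ^ (-((n : ℝ) + s)) *
        iteratedDeriv 2 (fun t => (fracPer n s (ψ t '' E) Ω).toReal) 0 := by
  simp only [hE.image_dilate hR, fracPer_smul hR, ENNReal.toReal_mul]
  rw [ENNReal.toReal_ofReal (by positivity), iteratedDeriv_const_mul_field]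

theorem le_setDist {α : Type*} [PseudoMetricSpace α] {A B : Set α} {c : ℝ} (hA : A.Nonempty)
    (hB : B.Nonempty) (h : ∀ a ∈ A, ∀ b ∈ B, c ≤ dist a b) : c ≤ setDist A B := by
  refine le_csInf (hA.image2 hB) ?_
  rintro _ ⟨a, ha, b, hb, rfl⟩
  exact h a ha b hb

theorem setDist_comm {α : Type*} [PseudoMetricSpace α] (A B : Set α) :
    setDist A B = setDist B A := by
  unfold setDist
  rw [image2_swap]
  simp only [dist_comm]

/-- Dilations of an annular set by well separated factors are far apart. -/
theorem le_dist_of_mem_smul {A : Set (Rn n)} {r M R₁ R₂ : ℝ}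
    (hr : ∀ x ∈ A, r ≤ ‖x‖) (hM : ∀ x ∈ A, ‖x‖ ≤ M) (hR₁ : 0 ≤ R₁) (hR₂ : 0 ≤ R₂)
    (h : R₁ * M ≤ R₂ * (r / 2)) :
    ∀ a ∈ R₁ • A, ∀ b ∈ R₂ • A, R₂ * (r / 2) ≤ dist a b := by
  rintro _ ⟨a, ha, rfl⟩ _ ⟨b, hb, rfl⟩
  have h1 : ‖R₂ • b‖ - ‖R₁ • a‖ ≤ ‖R₂ • b - R₁ • a‖ := norm_sub_norm_le _ _
  rw [norm_smul, norm_smul, Real.norm_of_nonneg hR₁, Real.norm_of_nonneg hR₂] at h1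
  have h2 := mul_le_mul_of_nonneg_left (hM a ha) hR₁
  have h3 := mul_le_mul_of_nonneg_left (hr b hb) hR₂
  change _ ≤ dist (R₁ • a) (R₂ • b)
  rw [dist_comm, dist_eq_norm]
  linarith

/-- The almost-stability property, applied to the dilations of one vector field by powers of a
large factor `ρ`, bounds its second variation from below. -/
theorem AlmostStableProperty.neg_rpow_le_iteratedDeriv {s : ℝ} {m : ℕ} {C₁ : ℝ}
    {E : Set (Rn n)} (hE : IsCone n E) (halmost : AlmostStableProperty n s m C₁ E)
    (hn : 1 ≤ n) (hs : 0 < s) (hC₁ : 0 < C₁) {Ω : Set (Rn n)} (hΩ : IsOpen Ω)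
    (hΩb : Bornology.IsBounded Ω) {X : Rn n → Rn n} (hX : ContDiff ℝ (⊤ : ℕ∞) X)
    (hXc : HasCompactSupport X) (hXΩ : tsupport X ⊆ Ω) (hne : (tsupport X).Nonempty)
    {ψ : ℝ → Rn n → Rn n} (hψ : IsFlowOf X ψ) {r M ρ : ℝ} (hr : 0 < r)
    (hrX : ∀ x ∈ tsupport X, r ≤ ‖x‖) (hMX : ∀ x ∈ tsupport X, ‖x‖ ≤ M) (hρ : 1 ≤ ρ)
    (hρM : M ≤ ρ * (r / 2)) :
    -(C₁ * supNorm X ^ 2 * Metric.diam (tsupport X) ^ (2 * (n - 1)) *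
        (2 * (m + 1) * (r / 2) ^ (-((n : ℝ) + s)))) * ρ ^ (-(((n : ℝ) + s) / 2)) ≤
      iteratedDeriv 2 (fun t => (fracPer n s (ψ t '' E) Ω).toReal) 0 := by
  have hρ0 : 0 < ρ := by linarith
  set p : ℝ := (n : ℝ) + s with hp
  have hp0 : 0 < p := by positivity
  set A := tsupport X with hA
  have hpow (i : Fin (m + 1)) : 0 < ρ ^ (i : ℕ) := by positivity
  have hstep {i l : Fin (m + 1)} (h : i < l) : ρ * ρ ^ (i : ℕ) ≤ ρ ^ (l : ℕ) := by
    rw [← pow_succ']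
    exact pow_le_pow_right₀ hρ h
  have hsep {i l : Fin (m + 1)} (h : i < l) : ∀ a ∈ ρ ^ (i : ℕ) • A, ∀ b ∈ ρ ^ (l : ℕ) • A,
      ρ ^ (l : ℕ) * (r / 2) ≤ dist a b := by
    refine le_dist_of_mem_smul hrX hMX (hpow i).le (hpow l).le ?_
    calc ρ ^ (i : ℕ) * M ≤ ρ ^ (i : ℕ) * (ρ * (r / 2)) := by gcongr
      _ = ρ * ρ ^ (i : ℕ) * (r / 2) := by ring
      _ ≤ _ := by gcongr; exact hstep h
  have hdist {i l : Fin (m + 1)} (h : i < l) :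
      ρ ^ (l : ℕ) * (r / 2) ≤ setDist (ρ ^ (i : ℕ) • A) (ρ ^ (l : ℕ) • A) :=
    le_setDist hne.smul_set hne.smul_set (hsep h)
  have hdisj {i l : Fin (m + 1)} (h : i < l) :
      Disjoint (ρ ^ (i : ℕ) • A) (ρ ^ (l : ℕ) • A) := by
    refine Set.disjoint_left.2 fun x hx hx' => ?_
    have h1 := hsep h x hx x hx'
    rw [dist_self] at h1
    have := mul_pos (hpow l) (half_pos hr)
    linarith
  obtain ⟨i, hi⟩ := halmost (fun i => dilateField (ρ ^ (i : ℕ)) X) (fun i => hX.dilateField)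
    (fun i => hXc.dilateField (hpow i))
    (fun i l hil => by
      simp only [tsupport_dilateField (hpow _)]
      rcases lt_or_gt_of_ne hil with h | h
      · exact hdisj h
      · exact (hdisj h).symm)
    (fun _ _ => ρ ^ (p / 2)) (fun _ _ _ => by positivity)
  have hi' := hi (ρ ^ (i : ℕ) • Ω) (hΩ.smul₀ (hpow i).ne') (hΩb.smul₀ _)
    (by rw [tsupport_dilateField (hpow i)]; exact smul_set_mono hXΩ)
    _ (hψ.dilateField (hpow i))
  simp only [tsupport_dilateField (hpow _), supNorm_dilateField (hpow _),
    hE.iteratedDeriv_fracPer_dilate (hpow i), ← hp, ← hA, diam_smul₀,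
    Real.norm_of_nonneg (hpow i).le] at hi'
  set R := ρ ^ (i : ℕ) with hR
  have hR0 : 0 < R := hpow i
  set T : ℝ := ρ ^ (-(p / 2)) * (R ^ (-p) * (r / 2) ^ (-p)) with hT
  have hlow : ∀ l ∈ Finset.univ.filter (fun l => l < i),
      (ρ ^ (p / 2))⁻¹ * setDist (R • A) (ρ ^ (l : ℕ) • A) ^ (-p) ≤ T := by
    intro l hl
    have h := hdist (Finset.mem_filter.1 hl).2
    rw [setDist_comm] at h
    rw [hT, Real.rpow_neg hρ0.le, ← Real.mul_rpow hR0.le (by positivity)]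
    gcongr ?_ * ?_
    exact Real.rpow_le_rpow_of_nonpos (by positivity) h (by linarith)
  have hhigh : ∀ l ∈ Finset.univ.filter (fun l => i < l),
      ρ ^ (p / 2) * setDist (R • A) (ρ ^ (l : ℕ) • A) ^ (-p) ≤ T := by
    intro l hl
    have hil := (Finset.mem_filter.1 hl).2
    have h : ρ * (R * (r / 2)) ≤ setDist (R • A) (ρ ^ (l : ℕ) • A) := by
      refine le_trans ?_ (hdist hil)
      rw [← mul_assoc]
      gcongr
      exact hstep hil
    have hT' : T = ρ ^ (p / 2) * (ρ * (R * (r / 2))) ^ (-p) := by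
      rw [Real.mul_rpow hρ0.le (by positivity), Real.mul_rpow hR0.le (by positivity),
        ← mul_assoc, ← Real.rpow_add hρ0, hT]
      ring_nf
    rw [hT']
    gcongr ?_ * ?_
    exact Real.rpow_le_rpow_of_nonpos (by positivity) h (by linarith)
  have hT0 : 0 ≤ T := by positivity
  have hcard (S : Finset (Fin (m + 1))) (f : Fin (m + 1) → ℝ) (hf : ∀ l ∈ S, f l ≤ T) :
      ∑ l ∈ S, f l ≤ (m + 1) * T := by
    refine (Finset.sum_le_card_nsmul S f T hf).trans ?_
    rw [nsmul_eq_mul]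
    gcongr
    exact_mod_cast (Finset.card_le_univ S).trans_eq (Fintype.card_fin _)
  have hsum := add_le_add (hcard _ _ hlow) (hcard _ _ hhigh)
  have hpos : 0 < R ^ (2 * n) * R ^ (-p) := by positivity
  refine le_of_mul_le_mul_left (le_trans ?_ hi') hpos
  have hcoef : C₁ * (R * supNorm X) ^ 2 * (R * Metric.diam A) ^ (2 * (n - 1)) =
      R ^ (2 * n) * (C₁ * supNorm X ^ 2 * Metric.diam A ^ (2 * (n - 1))) := by
    obtain ⟨k, rfl⟩ := Nat.exists_eq_add_of_le' hn
    simp only [Nat.add_sub_cancel]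
    ring
  rw [hcoef]
  have hc : 0 ≤ R ^ (2 * n) * (C₁ * supNorm X ^ 2 * Metric.diam A ^ (2 * (n - 1))) := by
    positivity
  calc _ = -(R ^ (2 * n) * (C₁ * supNorm X ^ 2 * Metric.diam A ^ (2 * (n - 1))) *
        ((m + 1) * T + (m + 1) * T)) := by rw [hT]; ring
    _ ≤ _ := neg_le_neg (mul_le_mul_of_nonneg_left hsum hc)

end Scaling


/-- **Cones of finite Morse index are stable away from the vertex** (Lemma 7.4 of the
paper): a cone with finite relative `s`-perimeter in `B₁` which is an `s`-minimal surface
in `ℝ^n` and satisfies the quantitative almost-stability property in one out of `m+1`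
disjoint sets is stable in `ℝ^n ∖ {0}`. -/
theorem cone_finite_index_is_stable
    (n : ℕ) (hn : 1 ≤ n) (s : ℝ) (hs : s ∈ Set.Ioo (0 : ℝ) 1)
    (E : Set (Rn n)) (hcone : IsCone n E)
    (hper : fracPer n s E (Metric.ball 0 1) < ⊤)
    (hmin : IsSMinimalOn n s E Set.univ)
    (m : ℕ) (C₁ : ℝ) (hC₁ : 0 < C₁)
    (halmost : AlmostStableProperty n s m C₁ E) :
    IsStableIn n s E ({0}ᶜ) := by
  intro Ω hΩ hΩb hΩ0 X hX hXc hXΩ ψ hψ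
  rcases (tsupport X).eq_empty_or_nonempty with hempty | hne
  · obtain rfl : X = 0 := tsupport_eq_empty_iff.1 hempty
    obtain ⟨i, hi⟩ := halmost (fun _ => 0) (fun _ => hX) (fun _ => hXc)
      (fun _ _ _ => by simp) (fun _ _ => 1) (fun _ _ _ => one_pos)
    simpa [supNorm] using hi Ω hΩ hΩb hXΩ ψ hψ
  · have h0 : (0 : Rn n) ∉ tsupport X := fun h => hΩ0 (subset_closure (hXΩ h)) rfl
    obtain ⟨r, hr, hrX⟩ :=
      Metric.isOpen_iff.1 (isClosed_tsupport X).isOpen_compl 0 h0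
    obtain ⟨M, hMX⟩ := isBounded_iff_forall_norm_le.1 (IsCompact.isBounded hXc)
    have hrX' : ∀ x ∈ tsupport X, r ≤ ‖x‖ := by
      intro x hx
      by_contra! h
      exact hrX (mem_ball_zero_iff.2 h) hx
    have hp : 0 < ((n : ℝ) + s) / 2 := by
      have := hs.1
      positivity
    have hlim := (tendsto_rpow_neg_atTop hp).const_mul
      (-(C₁ * supNorm X ^ 2 * Metric.diam (tsupport X) ^ (2 * (n - 1)) *
        (2 * (m + 1) * (r / 2) ^ (-((n : ℝ) + s)))))
    rw [mul_zero] at hlim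
    refine le_of_tendsto hlim ?_
    filter_upwards [eventually_ge_atTop 1, eventually_ge_atTop (M / (r / 2))] with ρ hρ hρM
    exact halmost.neg_rpow_le_iteratedDeriv hcone hn hs.1 hC₁ hΩ hΩb hX hXc hXΩ hne hψ hr hrX'
      hMX hρ ((div_le_iff₀ (half_pos hr)).1 hρM)

end
end

section
/- BV estimate for almost stable solutions of fractional Allen–Cahn (Euclidean version): let n ≥ 1 and s₀ ∈ (0,1). There exist constants Λ₀ > 0 and C > 0, depending only on n and s₀, such that for every s ∈ (s₀,1), every ε > 0, and every continuously differentiable solution u : ℝ^n → (-1,1) of the fractional Allen–Cahn equation with parameters s, ε in B₁(0) ⊆ ℝ^n which has bounded gradient and is Λ-almost stable in B₁(0) for some Λ ≤ Λ₀, one has ∫_{B_{1/4}(0)} |∇u| dx ≤ C/(1-s). -/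
open MeasureTheory Real Set Metric Filter Topology

noncomputable section

/-- The double-well potential `W(t) = (1-t²)²/4`. -/
def Wpot (t : ℝ) : ℝ := (1 - t ^ 2) ^ 2 / 4

/-- `u` solves the fractional Allen–Cahn equation
`(-Δ)^{s/2} u + ε^{-s} W'(u) = 0` (with `W'(t) = t³ - t`) in the open set `O`. -/
def IsACSol (n : ℕ) (s ε : ℝ) (u : Rn n → ℝ) (O : Set (Rn n)) : Prop :=
  ∀ x ∈ O, (∫ y, (u x - u y) * fracKer n s x y) + ε ^ (-s) * (u x ^ 3 - u x) = 0

/-- The second-variation quadratic form of the fractional Allen–Cahn energy at `u` in `Ω`,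
with `W''(t) = 3t² - 1`. -/
def Qform (n : ℕ) (s ε : ℝ) (u : Rn n → ℝ) (Ω : Set (Rn n)) (ξ : Rn n → ℝ) : ℝ :=
  (1 / 4) * (∫ p in ((Ωᶜ ×ˢ Ωᶜ)ᶜ : Set (Rn n × Rn n)),
      (ξ p.1 - ξ p.2) ^ 2 * fracKer n s p.1 p.2) +
    ε ^ (-s) * ∫ x in Ω, (3 * u x ^ 2 - 1) * ξ x ^ 2

/-- `ξ` is a `C¹` function compactly supported in `Ω`. -/
def IsCc1On (n : ℕ) (Ω : Set (Rn n)) (ξ : Rn n → ℝ) : Prop :=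
  ContDiff ℝ 1 ξ ∧ HasCompactSupport ξ ∧ tsupport ξ ⊆ Ω

/-- The Morse index of `u` in `Ω` is at most `m`: there is no `(m+1)`-dimensional subspace
of `C_c¹(Ω)` on which the second variation is negative definite. -/
def ACMorseIndexLE (n : ℕ) (s ε : ℝ) (u : Rn n → ℝ) (Ω : Set (Rn n)) (m : ℕ) : Prop :=
  ∀ ξ : Fin (m + 1) → Rn n → ℝ, (∀ i, IsCc1On n Ω (ξ i)) → LinearIndependent ℝ ξ →
    ∃ a : Fin (m + 1) → ℝ, a ≠ 0 ∧ 0 ≤ Qform n s ε u Ω (fun x => ∑ i, a i * ξ i x)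

/-- `u` is `Λ`-almost stable in `Ω`: `Q_Ω(ξ) ≥ -Λ (∫_Ω |ξ|)²` for all `ξ ∈ C_c¹(Ω)`. -/
def AlmostStable (n : ℕ) (s ε Λ : ℝ) (u : Rn n → ℝ) (Ω : Set (Rn n)) : Prop :=
  ∀ ξ : Rn n → ℝ, IsCc1On n Ω ξ → -(Λ * (∫ x in Ω, |ξ x|) ^ 2) ≤ Qform n s ε u Ω ξ

end

noncomputable section

/-- The integrable profile `min(|z|,1) |z|^{-(n+s)}` dominating every kernel expression below. -/
def domKer (n : ℕ) (s : ℝ) (z : Rn n) : ℝ := min ‖z‖ 1 * ‖z‖ ^ (-((n : ℝ) + s))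

lemma domKer_nonneg (n : ℕ) (s : ℝ) (z : Rn n) : 0 ≤ domKer n s z := by
  unfold domKer; positivity

lemma domKer_neg (n : ℕ) (s : ℝ) (z : Rn n) : domKer n s (-z) = domKer n s z := by
  simp [domKer]

lemma exists_alphaC_lower_bound (n : ℕ) (hn : 1 ≤ n) (s₀ : ℝ) (hs₀ : s₀ ∈ Set.Ioo (0 : ℝ) 1) :
    ∃ a : ℝ, 0 < a ∧ ∀ s ∈ Set.Ioo s₀ 1, a ≤ alphaC n s := by
  have hn' : (1 : ℝ) ≤ n := by exact_mod_cast hn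
  have hG : ∀ x : ℝ, 0 < x → ContinuousAt Real.Gamma x := fun x hx =>
    (Real.differentiableAt_Gamma fun m =>
      ((neg_nonpos.mpr (Nat.cast_nonneg m)).trans_lt hx).ne').continuousAt
  have hc : ContinuousOn (alphaC n) (Set.Icc s₀ 1) := by
    intro s hs
    have h1 : ContinuousAt (fun s : ℝ => Real.Gamma (((n : ℝ) + s) / 2)) s :=
      (hG _ (by linarith [hs.1, hs₀.1])).comp (f := fun s : ℝ => ((n : ℝ) + s) / 2) (by fun_prop)
    have h2 : ContinuousAt (fun s : ℝ => Real.Gamma (1 - s / 2)) s :=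
      (hG _ (by linarith [hs.2])).comp (f := fun s : ℝ => 1 - s / 2) (by fun_prop)
    have h3 : Real.pi ^ ((n : ℝ) / 2) * Real.Gamma (1 - s / 2) ≠ 0 :=
      (mul_pos (by positivity) (Real.Gamma_pos_of_pos (by linarith [hs.2]))).ne'
    have h4 : ContinuousAt (fun s : ℝ => (2 : ℝ) ^ (s - 1)) s :=
      ContinuousAt.rpow (by fun_prop) (by fun_prop) (Or.inl two_ne_zero)
    unfold alphaC
    exact (((continuousAt_id.mul h4).mul h1).div (continuousAt_const.mul h2) h3).continuousWithinAt
  obtain ⟨t, ht, hmin⟩ := isCompact_Icc.exists_isMinOn ⟨1, ⟨hs₀.2.le, le_rfl⟩⟩ hc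
  refine ⟨alphaC n t, ?_, fun s hs => hmin ⟨hs.1.le, hs.2.le⟩⟩
  have h0 : 0 < t := hs₀.1.trans_le ht.1
  have := Real.Gamma_pos_of_pos (s := ((n : ℝ) + t) / 2) (by linarith)
  have := Real.Gamma_pos_of_pos (s := 1 - t / 2) (by linarith [ht.2])
  unfold alphaC
  positivity

lemma integrable_domKer_and_integral_le (n : ℕ) (hn : 1 ≤ n) (s : ℝ) (hs : s ∈ Set.Ioo (0 : ℝ) 1) :
    Integrable (domKer n s) ∧
      ∫ z, domKer n s z ≤ n * volume.real (ball (0 : Rn n) 1) * (1 / (1 - s) + 1 / s) := by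
  have : Nonempty (Fin n) := ⟨⟨0, hn⟩⟩
  have hdim : Module.finrank ℝ (Rn n) = n := by simp
  set f : ℝ → ℝ := fun r => min r 1 * r ^ (-((n : ℝ) + s)) with hf
  have e1 : Set.EqOn (fun r : ℝ => r ^ (n - 1) • f r) (fun r => r ^ (-s)) (Ioc 0 1) := by
    intro r hr
    have h : r ^ (n - 1) * r = r ^ (n : ℝ) := by
      rw [← pow_succ, Nat.sub_add_cancel hn, Real.rpow_natCast]
    simp only [hf, smul_eq_mul, min_eq_left hr.2]
    rw [← mul_assoc, h, ← Real.rpow_add hr.1]; congr 1; ring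
  have e2 : Set.EqOn (fun r : ℝ => r ^ (n - 1) • f r) (fun r => r ^ (-1 - s)) (Ioi 1) := by
    intro r hr
    have hr0 : (0 : ℝ) < r := zero_lt_one.trans hr
    have h : r ^ (n - 1) = r ^ ((n : ℝ) - 1) := by
      rw [← Real.rpow_natCast, Nat.cast_sub hn, Nat.cast_one]
    simp only [hf, smul_eq_mul, min_eq_right (le_of_lt (mem_Ioi.1 hr)), one_mul]
    rw [h, ← Real.rpow_add hr0]; congr 1; ring
  have i1 : IntegrableOn (fun r : ℝ => r ^ (n - 1) • f r) (Ioc 0 1) := by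
    rw [integrableOn_congr_fun e1 measurableSet_Ioc,
      ← intervalIntegrable_iff_integrableOn_Ioc_of_le zero_le_one]
    exact intervalIntegral.intervalIntegrable_rpow' (by linarith [hs.2])
  have i2 : IntegrableOn (fun r : ℝ => r ^ (n - 1) • f r) (Ioi 1) := by
    rw [integrableOn_congr_fun e2 measurableSet_Ioi]
    exact integrableOn_Ioi_rpow_of_lt (by linarith [hs.1]) one_pos
  have hu : Ioc (0 : ℝ) 1 ∪ Ioi 1 = Ioi 0 := Ioc_union_Ioi_eq_Ioi zero_le_one
  have v1 : ∫ r in Ioc (0 : ℝ) 1, r ^ (n - 1) • f r = 1 / (1 - s) := by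
    rw [setIntegral_congr_fun measurableSet_Ioc e1, ← intervalIntegral.integral_of_le zero_le_one,
      integral_rpow (Or.inl (by linarith [hs.2]))]
    rw [Real.one_rpow, Real.zero_rpow (by linarith [hs.2])]
    congr 1 <;> ring
  have v2 : ∫ r in Ioi (1 : ℝ), r ^ (n - 1) • f r = 1 / s := by
    rw [setIntegral_congr_fun measurableSet_Ioi e2,
      integral_Ioi_rpow_of_lt (by linarith [hs.1]) one_pos, Real.one_rpow, neg_div, ← div_neg]
    congr 1; ring
  constructor
  · have := (integrable_fun_norm_addHaar (volume : Measure (Rn n)) (f := f)).2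
    rw [hdim] at this
    refine this ?_
    rw [← hu]
    exact i1.union i2
  · have := integral_fun_norm_addHaar (volume : Measure (Rn n)) f
    rw [hdim, ← hu, setIntegral_union (Ioc_disjoint_Ioi le_rfl) measurableSet_Ioi i1 i2,
      v1, v2] at this
    refine (this.trans ?_).le
    simp [mul_assoc]

lemma integrable_mul_domKer_sub (n : ℕ) (hn : 1 ≤ n) (s : ℝ) (hs : s ∈ Set.Ioo (0 : ℝ) 1)
    {f : Rn n → ℝ} (hf : Integrable f) :
    Integrable (fun p : Rn n × Rn n => f p.2 * domKer n s (p.1 - p.2)) :=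
  hf.convolution_integrand (ContinuousLinearMap.mul ℝ ℝ)
    (integrable_domKer_and_integral_le n hn s hs).1

lemma integrable_of_le_domKer_sub (n : ℕ) (hn : 1 ≤ n) (s : ℝ) (hs : s ∈ Set.Ioo (0 : ℝ) 1)
    {H : Rn n × Rn n → ℝ} (hH : AEStronglyMeasurable H) (C : ℝ)
    (hb : ∀ p, |H p| ≤ C * (((closedBall (0 : Rn n) (1 / 2)).indicator 1 p.1 +
      (closedBall (0 : Rn n) (1 / 2)).indicator 1 p.2) * domKer n s (p.1 - p.2))) :
    Integrable H := by
  have hi : Integrable ((closedBall (0 : Rn n) (1 / 2)).indicator (1 : Rn n → ℝ)) :=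
    (integrable_indicator_iff measurableSet_closedBall).2
      (integrableOn_const measure_closedBall_lt_top.ne)
  have h2 := integrable_mul_domKer_sub n hn s hs hi
  have h1 : Integrable (fun p : Rn n × Rn n =>
      (closedBall (0 : Rn n) (1 / 2)).indicator (1 : Rn n → ℝ) p.1 * domKer n s (p.1 - p.2)) := by
    have := h2.swap
    refine this.congr (Eventually.of_forall fun p => ?_)
    simp [← domKer_neg n s (p.2 - p.1)]
  refine ((h1.add h2).const_mul C).mono' hH (Eventually.of_forall fun p => ?_)
  refine (hb p).trans_eq ?_
  simp [add_mul]

lemma fracKer_comm (n : ℕ) (s : ℝ) (x y : Rn n) : fracKer n s x y = fracKer n s y x := by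
  simp [fracKer, norm_sub_rev]

lemma fracKer_nonneg {n : ℕ} {s : ℝ} (hα : 0 ≤ alphaC n s) (x y : Rn n) : 0 ≤ fracKer n s x y := by
  unfold fracKer; positivity

lemma fracKer_add_right (n : ℕ) (s : ℝ) (x y z : Rn n) :
    fracKer n s (x + z) (y + z) = fracKer n s x y := by
  simp [fracKer]

lemma measurable_fracKer (n : ℕ) (s : ℝ) :
    Measurable (fun p : Rn n × Rn n => fracKer n s p.1 p.2) := by
  unfold fracKer; fun_prop

lemma min_mul_fracKer (n : ℕ) (s : ℝ) (x y : Rn n) :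
    min ‖x - y‖ 1 * fracKer n s x y = alphaC n s * domKer n s (x - y) := by
  unfold fracKer domKer; ring

lemma measurable_fracKer_right (n : ℕ) (s : ℝ) (x : Rn n) : Measurable (fracKer n s x) := by
  unfold fracKer; fun_prop

lemma abs_sub_le_mul_min {n : ℕ} {f : Rn n → ℝ} {M N : ℝ} (hM : ∀ x, |f x| ≤ M)
    (hN : ∀ x y, |f x - f y| ≤ N * ‖x - y‖) (hN0 : 0 ≤ N) (x y : Rn n) :
    |f x - f y| ≤ (2 * M + N) * min ‖x - y‖ 1 := by
  have hM0 : 0 ≤ M := (abs_nonneg _).trans (hM 0)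
  rcases le_total ‖x - y‖ 1 with h | h
  · rw [min_eq_left h]
    have := mul_nonneg hM0 (norm_nonneg (x - y))
    linarith [hN x y]
  · rw [min_eq_right h]
    linarith [abs_sub (f x) (f y), hM x, hM y]

lemma integrable_mul_fracKer {n : ℕ} (hn : 1 ≤ n) {s : ℝ} (hs : s ∈ Set.Ioo (0 : ℝ) 1)
    (hα : 0 ≤ alphaC n s) {H : Rn n × Rn n → ℝ} (hH : Measurable H) (C : ℝ)
    (hb : ∀ p, |H p| ≤ C * ((closedBall (0 : Rn n) (1 / 2)).indicator 1 p.1 +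
      (closedBall (0 : Rn n) (1 / 2)).indicator 1 p.2) * min ‖p.1 - p.2‖ 1) :
    Integrable (fun p => H p * fracKer n s p.1 p.2) := by
  refine integrable_of_le_domKer_sub n hn s hs
    (hH.mul (measurable_fracKer n s)).aestronglyMeasurable (C * alphaC n s) fun p => ?_
  rw [abs_mul, abs_of_nonneg (fracKer_nonneg hα _ _)]
  refine (mul_le_mul_of_nonneg_right (hb p) (fracKer_nonneg hα _ _)).trans_eq ?_
  rw [mul_assoc, min_mul_fracKer]; ring

lemma integrable_sub_mul_fracKer {n : ℕ} (hn : 1 ≤ n) {s : ℝ} (hs : s ∈ Set.Ioo (0 : ℝ) 1)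
    (hα : 0 ≤ alphaC n s) {f : Rn n → ℝ} (hf : Continuous f) {M N : ℝ} (hM : ∀ x, |f x| ≤ M)
    (hN : ∀ x y, |f x - f y| ≤ N * ‖x - y‖) (hN0 : 0 ≤ N) (x : Rn n) :
    Integrable (fun y => (f x - f y) * fracKer n s x y) := by
  have hi : Integrable (fun y => (2 * M + N) * alphaC n s * domKer n s (x - y)) :=
    ((integrable_domKer_and_integral_le n hn s hs).1.comp_sub_left x).const_mul _
  have hf' : Measurable (fun y => f x - f y) := (continuous_const.sub hf).measurable
  refine hi.mono' (hf'.mul (measurable_fracKer_right n s x)).aestronglyMeasurable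
    (Eventually.of_forall fun y => ?_)
  rw [Real.norm_eq_abs, abs_mul, abs_of_nonneg (fracKer_nonneg hα _ _)]
  refine (mul_le_mul_of_nonneg_right (abs_sub_le_mul_min hM hN hN0 x y)
    (fracKer_nonneg hα _ _)).trans_eq ?_
  rw [mul_assoc, min_mul_fracKer]; ring

/-- A Lipschitz cutoff function with values in `[0,1]`, supported in the closed ball of
radius `1/2`. -/
structure IsCutoff (n : ℕ) (L : ℝ) (η : Rn n → ℝ) : Prop where
  cont : Continuous η
  nonneg : ∀ x, 0 ≤ η x
  le_one : ∀ x, η x ≤ 1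
  eq_zero : ∀ x, x ∉ closedBall (0 : Rn n) (1 / 2) → η x = 0
  lip_nonneg : 0 ≤ L
  lip : ∀ x y, |η x - η y| ≤ L * ‖x - y‖

lemma IsCutoff.abs_le_one {n : ℕ} {L : ℝ} {η : Rn n → ℝ} (h : IsCutoff n L η) (x : Rn n) :
    |η x| ≤ 1 := by
  rw [abs_of_nonneg (h.nonneg x)]; exact h.le_one x

lemma IsCutoff.sq_sub_le {n : ℕ} {L : ℝ} {η : Rn n → ℝ} (h : IsCutoff n L η) (x y : Rn n) :
    (η x - η y) ^ 2 ≤ (2 + L) ^ 2 * ((closedBall (0 : Rn n) (1 / 2)).indicator 1 x +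
      (closedBall (0 : Rn n) (1 / 2)).indicator 1 y) * min ‖x - y‖ 1 := by
  have h1 := abs_sub_le_mul_min h.abs_le_one h.lip h.lip_nonneg x y
  have h0 : 0 ≤ min ‖x - y‖ 1 := by positivity
  have h2 : (η x - η y) ^ 2 ≤ (2 + L) ^ 2 * min ‖x - y‖ 1 := by
    calc (η x - η y) ^ 2 = |η x - η y| ^ 2 := (sq_abs _).symm
      _ ≤ ((2 * 1 + L) * min ‖x - y‖ 1) ^ 2 := pow_le_pow_left₀ (abs_nonneg _) h1 2
      _ = (2 + L) ^ 2 * (min ‖x - y‖ 1 * min ‖x - y‖ 1) := by ring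
      _ ≤ (2 + L) ^ 2 * (min ‖x - y‖ 1 * 1) := by gcongr; exact min_le_right _ _
      _ = _ := by ring
  by_cases hx : x ∈ closedBall (0 : Rn n) (1 / 2) <;>
    by_cases hy : y ∈ closedBall (0 : Rn n) (1 / 2)
  · rw [indicator_of_mem hx, indicator_of_mem hy]
    have : 0 ≤ (2 + L) ^ 2 * min ‖x - y‖ 1 := by positivity
    simp only [Pi.one_apply]; linarith
  · rw [indicator_of_mem hx, indicator_of_notMem hy]; simpa using h2
  · rw [indicator_of_notMem hx, indicator_of_mem hy]; simpa using h2
  · rw [indicator_of_notMem hx, indicator_of_notMem hy, h.eq_zero x hx, h.eq_zero y hy]; simp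

lemma IsCutoff.integrable_sq_sub {n : ℕ} (hn : 1 ≤ n) {s : ℝ} (hs : s ∈ Set.Ioo (0 : ℝ) 1)
    (hα : 0 ≤ alphaC n s) {L : ℝ} {η : Rn n → ℝ} (h : IsCutoff n L η) :
    Integrable (fun p : Rn n × Rn n => (η p.1 - η p.2) ^ 2 * fracKer n s p.1 p.2) := by
  have hm : Measurable (fun p : Rn n × Rn n => (η p.1 - η p.2) ^ 2) :=
    ((h.cont.comp continuous_fst).sub (h.cont.comp continuous_snd)).measurable.pow_const 2
  refine integrable_mul_fracKer hn hs hα hm ((2 + L) ^ 2) fun p => ?_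
  rw [abs_of_nonneg (sq_nonneg _)]
  exact h.sq_sub_le p.1 p.2

lemma IsCutoff.integrable_sq_sub_mul {n : ℕ} (hn : 1 ≤ n) {s : ℝ} (hs : s ∈ Set.Ioo (0 : ℝ) 1)
    (hα : 0 ≤ alphaC n s) {L : ℝ} {η : Rn n → ℝ} (h : IsCutoff n L η) {w : Rn n → ℝ}
    (hw : Continuous w) {M : ℝ} (hM : ∀ x, |w x| ≤ M) :
    Integrable (fun p : Rn n × Rn n =>
      (η p.1 - η p.2) ^ 2 * fracKer n s p.1 p.2 * (w p.1 * w p.2)) := by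
  refine (h.integrable_sq_sub hn hs hα).mul_bdd (c := M * M)
    ((hw.comp continuous_fst).mul (hw.comp continuous_snd)).aestronglyMeasurable
    (Eventually.of_forall fun p => ?_)
  rw [Real.norm_eq_abs, abs_mul]
  exact mul_le_mul (hM _) (hM _) (abs_nonneg _) ((abs_nonneg _).trans (hM p.1))

/-- The localized energy identity for a solution `w` of a linear nonlocal equation. -/
lemma IsCutoff.integral_sq_sub_mul_eq {n : ℕ} (hn : 1 ≤ n) {s : ℝ} (hs : s ∈ Set.Ioo (0 : ℝ) 1)
    (hα : 0 ≤ alphaC n s) {L : ℝ} {η : Rn n → ℝ} (h : IsCutoff n L η) {w b : Rn n → ℝ}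
    (hw : Continuous w) {M N : ℝ} (hM : ∀ x, |w x| ≤ M)
    (hN : ∀ x y, |w x - w y| ≤ N * ‖x - y‖) (hN0 : 0 ≤ N)
    (heq : ∀ x ∈ closedBall (0 : Rn n) (1 / 2),
      ∫ y, (w x - w y) * fracKer n s x y = -(b x * w x)) :
    Integrable (fun p : Rn n × Rn n =>
      (η p.1 * w p.1 - η p.2 * w p.2) ^ 2 * fracKer n s p.1 p.2) ∧
    ∫ p : Rn n × Rn n, (η p.1 * w p.1 - η p.2 * w p.2) ^ 2 * fracKer n s p.1 p.2 =
      (∫ p : Rn n × Rn n, (η p.1 - η p.2) ^ 2 * fracKer n s p.1 p.2 * (w p.1 * w p.2)) -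
        2 * ∫ x, b x * (η x * w x) ^ 2 := by
  have hM0 : 0 ≤ M := (abs_nonneg _).trans (hM 0)
  set T : Rn n × Rn n → ℝ := fun p =>
    (η p.1 ^ 2 * w p.1 * (w p.1 - w p.2)) * fracKer n s p.1 p.2 with hT
  have hTi : Integrable T := by
    have hm : Measurable (fun p : Rn n × Rn n => η p.1 ^ 2 * w p.1 * (w p.1 - w p.2)) :=
      ((((h.cont.comp continuous_fst).pow 2).mul (hw.comp continuous_fst)).mul
        ((hw.comp continuous_fst).sub (hw.comp continuous_snd))).measurable
    refine integrable_mul_fracKer hn hs hα hm (M * (2 * M + N)) fun p => ?_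
    have h1 := abs_sub_le_mul_min hM hN hN0 p.1 p.2
    have hi : ∀ x : Rn n, (0 : ℝ) ≤ (closedBall (0 : Rn n) (1 / 2)).indicator 1 x :=
      fun x => indicator_nonneg (fun _ _ => zero_le_one) x
    have h2 : |η p.1 ^ 2 * w p.1| ≤ M * (closedBall (0 : Rn n) (1 / 2)).indicator 1 p.1 := by
      by_cases hx : p.1 ∈ closedBall (0 : Rn n) (1 / 2)
      · rw [indicator_of_mem hx, abs_mul, abs_of_nonneg (sq_nonneg _)]
        have := pow_le_one₀ (n := 2) (h.nonneg p.1) (h.le_one p.1)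
        calc _ ≤ 1 * M := mul_le_mul this (hM _) (abs_nonneg _) zero_le_one
          _ = _ := by simp
      · rw [indicator_of_notMem hx, h.eq_zero _ hx]; simp
    rw [abs_mul]
    calc _ ≤ (M * (closedBall (0 : Rn n) (1 / 2)).indicator 1 p.1) *
          ((2 * M + N) * min ‖p.1 - p.2‖ 1) :=
          mul_le_mul h2 h1 (abs_nonneg _) (mul_nonneg hM0 (hi _))
      _ = M * (2 * M + N) * (closedBall (0 : Rn n) (1 / 2)).indicator 1 p.1 *
          min ‖p.1 - p.2‖ 1 := by ring
      _ ≤ _ := by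
        gcongr
        linarith [hi p.2]
  have hJi := h.integrable_sq_sub_mul hn hs hα hw hM
  have hpt : (fun p : Rn n × Rn n =>
      (η p.1 * w p.1 - η p.2 * w p.2) ^ 2 * fracKer n s p.1 p.2) = fun p =>
      (η p.1 - η p.2) ^ 2 * fracKer n s p.1 p.2 * (w p.1 * w p.2) + (T p + T p.swap) := by
    funext p
    simp only [hT, Prod.fst_swap, Prod.snd_swap, fracKer_comm n s p.2 p.1]
    ring
  have hTs : ∫ p : Rn n × Rn n, T p.swap = ∫ p, T p := integral_prod_swap T
  have hTv : ∫ p, T p = -∫ x, b x * (η x * w x) ^ 2 := by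
    rw [← integral_neg]
    refine (integral_prod T hTi).trans (integral_congr_ae (Eventually.of_forall fun x => ?_))
    simp only [hT]
    by_cases hx : x ∈ closedBall (0 : Rn n) (1 / 2)
    · simp_rw [mul_assoc (η x ^ 2 * w x)]
      rw [integral_const_mul, heq x hx]; ring
    · simp [h.eq_zero x hx]
  rw [hpt]
  have hTi' : Integrable (fun p : Rn n × Rn n => T p.swap) := hTi.swap
  have hTT : Integrable (fun p : Rn n × Rn n => T p + T p.swap) := hTi.add hTi'
  refine ⟨hJi.add hTT, ?_⟩
  rw [integral_add hJi hTT, integral_add hTi hTi', hTs, hTv]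
  ring

lemma sq_integral_abs_le {n : ℕ} {ξ : Rn n → ℝ} (hξ : Continuous ξ)
    (h0 : ∀ x, x ∉ closedBall (0 : Rn n) (1 / 2) → ξ x = 0) :
    (∫ x, |ξ x|) ^ 2 ≤ volume.real (closedBall (0 : Rn n) (1 / 2)) *
      ∫ x in closedBall (0 : Rn n) (1 / 2), ξ x ^ 2 := by
  set B := closedBall (0 : Rn n) (1 / 2)
  have hV : 0 < volume.real B :=
    ENNReal.toReal_pos (measure_closedBall_pos _ _ (by norm_num)).ne' measure_closedBall_lt_top.ne
  have hK : IsCompact B := isCompact_closedBall _ _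
  have e1 : ∫ x, |ξ x| = ∫ x in B, |ξ x| := by
    refine (setIntegral_eq_integral_of_forall_compl_eq_zero fun x hx => ?_).symm
    rw [h0 x hx, abs_zero]
  rw [e1]
  set t := ∫ x in B, |ξ x| with ht
  have i1 : IntegrableOn (fun x => |ξ x|) B := hξ.abs.continuousOn.integrableOn_compact hK
  have i2 : IntegrableOn (fun x => ξ x ^ 2) B := (hξ.pow 2).continuousOn.integrableOn_compact hK
  have i3 : IntegrableOn (fun _ : Rn n => (t / volume.real B) ^ 2) B :=
    integrableOn_const measure_closedBall_lt_top.ne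
  have h : 0 ≤ ∫ x in B, (|ξ x| - t / volume.real B) ^ 2 := integral_nonneg fun x => sq_nonneg _
  have e2 : ∫ x in B, (|ξ x| - t / volume.real B) ^ 2 =
      (∫ x in B, ξ x ^ 2) - 2 * (t / volume.real B) * t + volume.real B * (t / volume.real B) ^ 2 := by
    have : (fun x => (|ξ x| - t / volume.real B) ^ 2) =
        fun x => ξ x ^ 2 - 2 * (t / volume.real B) * |ξ x| + (t / volume.real B) ^ 2 := by
      funext x; rw [sub_sq, sq_abs]; ring
    have i4 : IntegrableOn (fun x => 2 * (t / volume.real B) * |ξ x|) B := i1.const_mul _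
    have i5 : IntegrableOn (fun x => ξ x ^ 2 - 2 * (t / volume.real B) * |ξ x|) B := i2.sub i4
    rw [this, integral_add i5 i3, integral_sub i2 i4, integral_const_mul, ← ht, setIntegral_const,
      smul_eq_mul]
  rw [e2] at h
  have : (∫ x in B, ξ x ^ 2) - 2 * (t / volume.real B) * t +
      volume.real B * (t / volume.real B) ^ 2 = (∫ x in B, ξ x ^ 2) - t ^ 2 / volume.real B := by
    field_simp; ring
  rw [this, sub_nonneg, div_le_iff₀ hV] at h
  linarith

/-- A Poincaré inequality controlling the `L¹` norm by the Gagliardo seminorm. -/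
lemma sq_integral_abs_le_seminorm {n : ℕ} (hn : 1 ≤ n) {s : ℝ} (hs : s ∈ Set.Ioo (0 : ℝ) 1)
    (hα : 0 ≤ alphaC n s) {ξ : Rn n → ℝ} (hξ : Continuous ξ)
    (h0 : ∀ x, x ∉ closedBall (0 : Rn n) (1 / 2) → ξ x = 0)
    (hi : Integrable (fun p : Rn n × Rn n => (ξ p.1 - ξ p.2) ^ 2 * fracKer n s p.1 p.2)) :
    alphaC n s * (3 : ℝ) ^ (-((n : ℝ) + 1)) * (∫ x, |ξ x|) ^ 2 ≤
      ∫ p : Rn n × Rn n, (ξ p.1 - ξ p.2) ^ 2 * fracKer n s p.1 p.2 := by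
  have : Nonempty (Fin n) := ⟨⟨0, hn⟩⟩
  obtain ⟨z, hz⟩ := exists_norm_eq (Rn n) (c := 3 / 2) (by norm_num)
  set B := closedBall (0 : Rn n) (1 / 2) with hB
  set A := ball z (1 / 2) with hA
  set k := alphaC n s * (3 : ℝ) ^ (-((n : ℝ) + 1)) with hk
  have hvol : volume.real A = volume.real B := by
    rw [hB, Measure.addHaar_real_closedBall_eq_addHaar_real_ball, hA, measureReal_def,
      measureReal_def, Measure.addHaar_ball_center]
  have i2 : IntegrableOn (fun x => ξ x ^ 2) B :=
    (hξ.pow 2).continuousOn.integrableOn_compact (isCompact_closedBall _ _)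
  have i3 : IntegrableOn (fun _ : Rn n => k) A := integrableOn_const measure_ball_lt_top.ne
  have i4 : IntegrableOn (fun p : Rn n × Rn n => ξ p.1 ^ 2 * k) (B ×ˢ A) := by
    rw [IntegrableOn, Measure.volume_eq_prod, ← Measure.prod_restrict]
    exact Integrable.mul_prod i2 i3
  have hpos : ∀ p : Rn n × Rn n, 0 ≤ (ξ p.1 - ξ p.2) ^ 2 * fracKer n s p.1 p.2 := fun p =>
    mul_nonneg (sq_nonneg _) (fracKer_nonneg hα _ _)
  have step : ∫ p in B ×ˢ A, ξ p.1 ^ 2 * k ≤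
      ∫ p in B ×ˢ A, (ξ p.1 - ξ p.2) ^ 2 * fracKer n s p.1 p.2 := by
    refine setIntegral_mono_on i4 hi.integrableOn
      (measurableSet_closedBall.prod measurableSet_ball) fun p hp => ?_
    have h1 : ‖p.1‖ ≤ 1 / 2 := by simpa [hB] using hp.1
    have h2 : ‖p.2 - z‖ < 1 / 2 := by simpa [hA, dist_eq_norm] using hp.2
    have h3 : 1 < ‖p.2‖ := by
      have := norm_sub_norm_le z p.2
      rw [norm_sub_rev] at this; linarith
    have h4 : ‖p.2‖ < 2 := by
      have := norm_sub_norm_le p.2 z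
      linarith
    have h5 : ξ p.2 = 0 := h0 _ (by simp [hB]; linarith)
    have h6 : 0 < ‖p.1 - p.2‖ := by
      have := norm_sub_norm_le p.2 p.1
      rw [norm_sub_rev] at this; linarith
    have h7 : ‖p.1 - p.2‖ ≤ 3 := by linarith [norm_sub_le p.1 p.2]
    have h8 : (3 : ℝ) ^ (-((n : ℝ) + 1)) ≤ ‖p.1 - p.2‖ ^ (-((n : ℝ) + s)) :=
      (Real.rpow_le_rpow_of_exponent_le (by norm_num) (by linarith [hs.2])).trans
        (Real.rpow_le_rpow_of_nonpos h6 h7 (by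
          have : (0 : ℝ) ≤ n := n.cast_nonneg
          linarith [hs.1]))
    rw [h5, sub_zero]
    exact mul_le_mul_of_nonneg_left (mul_le_mul_of_nonneg_left h8 hα) (sq_nonneg _)
  have e : ∫ p in B ×ˢ A, ξ p.1 ^ 2 * k = (∫ x in B, ξ x ^ 2) * (volume.real B * k) := by
    have := setIntegral_prod_mul (μ := (volume : Measure (Rn n))) (ν := (volume : Measure (Rn n)))
      (fun x => ξ x ^ 2) (fun _ => k) B A
    rw [setIntegral_const, smul_eq_mul, hvol] at this
    exact this
  have hk0 : 0 ≤ k := by positivity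
  calc k * (∫ x, |ξ x|) ^ 2 ≤ k * (volume.real B * ∫ x in B, ξ x ^ 2) := by
        gcongr; exact sq_integral_abs_le hξ h0
    _ = ∫ p in B ×ˢ A, ξ p.1 ^ 2 * k := by rw [e]; ring
    _ ≤ _ := step
    _ ≤ _ := setIntegral_le_integral hi (Eventually.of_forall hpos)

lemma hasDerivAt_max_zero_sq (t : ℝ) : HasDerivAt (fun r : ℝ => max r 0 ^ 2) (2 * max t 0) t := by
  rcases lt_trichotomy t 0 with h | h | h
  · rw [max_eq_right h.le, mul_zero]
    refine (hasDerivAt_const t (0 : ℝ)).congr_of_eventuallyEq ?_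
    filter_upwards [Iio_mem_nhds h] with r hr
    simp [max_eq_right (mem_Iio.1 hr).le]
  · subst h
    have h1 : HasDerivWithinAt (fun r : ℝ => max r 0 ^ 2) (2 * max 0 0) (Iic 0) 0 := by
      have := (hasDerivAt_const (0 : ℝ) (0 : ℝ)).hasDerivWithinAt (s := Iic 0)
      rw [max_self, mul_zero]
      exact this.congr (fun r hr => by simp [max_eq_right (mem_Iic.1 hr)]) (by simp)
    have h2 : HasDerivWithinAt (fun r : ℝ => max r 0 ^ 2) (2 * max 0 0) (Ici 0) 0 := by
      have := (hasDerivAt_pow 2 (0 : ℝ)).hasDerivWithinAt (s := Ici 0)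
      refine (this.congr (fun r hr => by simp [max_eq_left (mem_Ici.1 hr)]) (by simp)).congr_deriv ?_
      simp
    have := h1.union h2
    rwa [Iic_union_Ici, hasDerivWithinAt_univ] at this
  · rw [max_eq_left h.le]
    refine ((hasDerivAt_pow 2 t).congr_deriv (by simp)).congr_of_eventuallyEq ?_
    filter_upwards [Ioi_mem_nhds h] with r hr
    simp [max_eq_left (mem_Ioi.1 hr).le]

/-- The regularized kernel `α_{n,s} (|x-y|² + δ)^{-(n+s)/2}`. -/
def regKer (n : ℕ) (s δ : ℝ) (x y : Rn n) : ℝ :=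
  alphaC n s * (‖x - y‖ ^ 2 + δ) ^ (-(((n : ℝ) + s) / 2))

lemma regKer_nonneg {n : ℕ} {s δ : ℝ} (hα : 0 ≤ alphaC n s) (hδ : 0 < δ) (x y : Rn n) :
    0 ≤ regKer n s δ x y := by
  unfold regKer; positivity

lemma regKer_le_fracKer {n : ℕ} {s δ : ℝ} (hs : s ∈ Set.Ioo (0 : ℝ) 1) (hα : 0 ≤ alphaC n s)
    (hδ : 0 < δ) {x y : Rn n} (hxy : x ≠ y) : regKer n s δ x y ≤ fracKer n s x y := by
  have hz : 0 < ‖x - y‖ := norm_pos_iff.2 (sub_ne_zero.2 hxy)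
  have hn : (0 : ℝ) ≤ n := n.cast_nonneg
  refine mul_le_mul_of_nonneg_left ?_ hα
  calc (‖x - y‖ ^ 2 + δ) ^ (-(((n : ℝ) + s) / 2)) ≤ (‖x - y‖ ^ 2) ^ (-(((n : ℝ) + s) / 2)) :=
        Real.rpow_le_rpow_of_nonpos (by positivity) (by linarith) (by linarith [hs.1])
    _ = _ := by
        rw [← Real.rpow_natCast, ← Real.rpow_mul hz.le]; congr 1; push_cast; ring

lemma tendsto_regKer {n : ℕ} {s : ℝ} {x y : Rn n} (hxy : x ≠ y) :
    Tendsto (fun δ => regKer n s δ x y) (𝓝[>] 0) (𝓝 (fracKer n s x y)) := by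
  have hz : 0 < ‖x - y‖ := norm_pos_iff.2 (sub_ne_zero.2 hxy)
  have hc : ContinuousAt (fun δ => regKer n s δ x y) 0 := by
    unfold regKer
    refine continuousAt_const.mul (ContinuousAt.rpow_const (by fun_prop) (Or.inl ?_))
    positivity
  have h := hc.tendsto.mono_left (nhdsWithin_le_nhds (s := Ioi 0))
  convert h using 2
  unfold regKer fracKer
  rw [add_zero, ← Real.rpow_natCast, ← Real.rpow_mul hz.le]; congr 2; push_cast; ring

lemma exists_hasFDerivAt_regKer {n : ℕ} {s δ : ℝ} (hs : s ∈ Set.Ioo (0 : ℝ) 1)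
    (hα : 0 ≤ alphaC n s) (hδ : 0 < δ) (x y : Rn n) :
    ∃ D : Rn n →L[ℝ] ℝ, HasFDerivAt (regKer n s δ x) D y ∧
      (x ≠ y → ∀ e : Rn n, ‖e‖ ≤ 1 → ‖x - y‖ * |D e| ≤ (n + 1) * fracKer n s x y) := by
  have hn : (0 : ℝ) ≤ n := n.cast_nonneg
  have hpos : 0 < ‖x - y‖ ^ 2 + δ := by positivity
  have h1 : HasFDerivAt (fun y => x - y) (-ContinuousLinearMap.id ℝ (Rn n)) y :=
    (hasFDerivAt_id y).const_sub x
  have h2 := (h1.norm_sq.add_const δ)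
  have h3 := (h2.rpow_const (p := -(((n : ℝ) + s) / 2)) (Or.inl hpos.ne')).const_mul (alphaC n s)
  refine ⟨_, h3, fun hxy e he => ?_⟩
  have hz : 0 < ‖x - y‖ := norm_pos_iff.2 (sub_ne_zero.2 hxy)
  have hin : |inner ℝ (x - y) e| ≤ ‖x - y‖ :=
    (abs_real_inner_le_norm _ _).trans (mul_le_of_le_one_right (norm_nonneg _) he)
  have hpow : (‖x - y‖ ^ 2 + δ) ^ (-(((n : ℝ) + s) / 2) - 1) * ‖x - y‖ ^ 2 ≤
      ‖x - y‖ ^ (-((n : ℝ) + s)) := by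
    calc _ ≤ (‖x - y‖ ^ 2) ^ (-(((n : ℝ) + s) / 2) - 1) * ‖x - y‖ ^ 2 := by
          refine mul_le_mul_of_nonneg_right ?_ (by positivity)
          exact Real.rpow_le_rpow_of_nonpos (by positivity) (by linarith) (by linarith [hs.1])
      _ = _ := by
          rw [← Real.rpow_add_one (by positivity), sub_add_cancel, ← Real.rpow_natCast,
            ← Real.rpow_mul hz.le]; congr 1; push_cast; ring
  simp only [_root_.smul_apply, smul_eq_mul, ContinuousLinearMap.comp_apply,
    _root_.neg_apply, ContinuousLinearMap.id_apply, innerSL_apply_apply,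
    inner_neg_right, nsmul_eq_mul]
  set B := (‖x - y‖ ^ 2 + δ) ^ (-(((n : ℝ) + s) / 2) - 1) with hB
  have hB0 : 0 ≤ B := by positivity
  have e1 : alphaC n s * (-(((n : ℝ) + s) / 2) * B * (((2 : ℕ) : ℝ) * -inner ℝ (x - y) e)) =
      alphaC n s * ((n : ℝ) + s) * B * inner ℝ (x - y) e := by push_cast; ring
  have h0 : 0 ≤ alphaC n s * ((n : ℝ) + s) * B :=
    mul_nonneg (mul_nonneg hα (by linarith [hs.1])) hB0
  rw [e1, abs_mul, abs_of_nonneg h0]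
  have hk : 0 ≤ ‖x - y‖ ^ (-((n : ℝ) + s)) := by positivity
  calc ‖x - y‖ * (alphaC n s * ((n : ℝ) + s) * B * |inner ℝ (x - y) e|)
      ≤ ‖x - y‖ * (alphaC n s * ((n : ℝ) + s) * B * ‖x - y‖) := by gcongr
    _ = alphaC n s * ((n : ℝ) + s) * (B * ‖x - y‖ ^ 2) := by ring
    _ ≤ alphaC n s * ((n : ℝ) + 1) * ‖x - y‖ ^ (-((n : ℝ) + s)) := by
        have := hs.2.le
        gcongr
    _ = _ := by unfold fracKer; ring

/-- One-sided integration by parts against the kernel with a quadratic cutoff: the singular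
weight `((η x - η y)₊)²` is controlled by `η x` itself. -/
lemma abs_integral_posPart_mul_fderiv_le {n : ℕ} (hn : 1 ≤ n) {s : ℝ}
    (hs : s ∈ Set.Ioo (0 : ℝ) 1) (hα : 0 ≤ alphaC n s) {L : ℝ} {ψ : Rn n → ℝ}
    (hψ : IsCutoff n L ψ) (hψ' : ContDiff ℝ 1 ψ) {u : Rn n → ℝ} (hu : ContDiff ℝ 1 u)
    (hu1 : ∀ x, |u x| ≤ 1) {K : ℝ} (hK : ∀ x, ‖fderiv ℝ u x‖ ≤ K) {e : Rn n} (he : ‖e‖ ≤ 1)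
    (x : Rn n) :
    |∫ y, max (ψ x ^ 2 - ψ y ^ 2) 0 ^ 2 * fracKer n s x y * fderiv ℝ u y e| ≤
      (4 * L * (2 * L + 1) + (2 * L + 1) ^ 2 * (n + 1)) * alphaC n s * (∫ z, domKer n s z) *
        ψ x ^ 2 := by
  have hL := hψ.lip_nonneg
  set P : Rn n → ℝ := fun y => max (ψ x ^ 2 - ψ y ^ 2) 0 with hP
  have hP0 : ∀ y, 0 ≤ P y := fun y => le_max_right _ _
  have hPm : ∀ y, P y ≤ (2 * L + 1) * ψ x * min ‖x - y‖ 1 := by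
    intro y
    have h0 : 0 ≤ min ‖x - y‖ 1 := by positivity
    have hx := hψ.nonneg x
    have hy := hψ.nonneg y
    refine max_le ?_ (by positivity)
    rcases le_total (ψ x) (ψ y) with h | h
    · have : ψ x ^ 2 ≤ ψ y ^ 2 := pow_le_pow_left₀ hx h 2
      have : 0 ≤ (2 * L + 1) * ψ x * min ‖x - y‖ 1 := by positivity
      linarith
    · rcases le_total ‖x - y‖ 1 with h1 | h1
      · rw [min_eq_left h1]
        have h2 : ψ x - ψ y ≤ L * ‖x - y‖ := (le_abs_self _).trans (hψ.lip x y)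
        calc ψ x ^ 2 - ψ y ^ 2 = (ψ x + ψ y) * (ψ x - ψ y) := by ring
          _ ≤ (2 * ψ x) * (L * ‖x - y‖) :=
            mul_le_mul (by linarith) h2 (by linarith) (by linarith)
          _ ≤ (2 * ψ x) * (L * ‖x - y‖) + ψ x * ‖x - y‖ := le_add_of_nonneg_right (by positivity)
          _ = _ := by ring
      · rw [min_eq_right h1]
        nlinarith [hψ.le_one x, mul_nonneg hL hx, sq_nonneg (ψ y), mul_nonneg hx
          (sub_nonneg.2 (hψ.le_one x))]
  have hPx : P x = 0 := by simp [hP]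
  have hPc : Continuous P := ((continuous_const.sub (hψ.cont.pow 2)).max continuous_const)
  have hPψ : ∀ y, P y * ψ y ≤ P y * ψ x := by
    intro y
    rcases le_total (ψ y) (ψ x) with h | h
    · exact mul_le_mul_of_nonneg_left h (hP0 y)
    · have : P y = 0 := max_eq_right (sub_nonpos.2 (pow_le_pow_left₀ (hψ.nonneg x) h 2))
      simp [this]
  have hPsq : ∀ y, P y ^ 2 ≤ (2 * L + 1) ^ 2 * ψ x ^ 2 * min ‖x - y‖ 1 ^ 2 := fun y =>
    (pow_le_pow_left₀ (hP0 y) (hPm y) 2).trans_eq (by ring)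
  have hF : ∀ y, P y ^ 2 * fracKer n s x y ≤
      (2 * L + 1) ^ 2 * alphaC n s * domKer n s (x - y) := by
    intro y
    have h0 := fracKer_nonneg hα x y
    calc _ ≤ (2 * L + 1) ^ 2 * 1 * (min ‖x - y‖ 1 * 1) * fracKer n s x y := by
          refine mul_le_mul_of_nonneg_right ((hPsq y).trans ?_) h0
          rw [sq (min _ _)]
          gcongr
          · exact pow_le_one₀ (hψ.nonneg x) (hψ.le_one x)
          · exact min_le_right _ _
      _ = (2 * L + 1) ^ 2 * (min ‖x - y‖ 1 * fracKer n s x y) := by ring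
      _ = _ := by rw [min_mul_fracKer]; ring
  have hFδ : ∀ δ, 0 < δ → ∀ y, P y ^ 2 * regKer n s δ x y ≤
      (2 * L + 1) ^ 2 * alphaC n s * domKer n s (x - y) := by
    intro δ hδ y
    rcases eq_or_ne x y with rfl | hxy
    · rw [hPx]
      have := domKer_nonneg n s (x - x)
      simp only [ne_eq, OfNat.ofNat_ne_zero, not_false_eq_true, zero_pow, zero_mul]
      positivity
    · exact (mul_le_mul_of_nonneg_left (regKer_le_fracKer hs hα hδ hxy) (sq_nonneg _)).trans (hF y)
  have hdom : Integrable (fun y => domKer n s (x - y)) :=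
    (integrable_domKer_and_integral_le n hn s hs).1.comp_sub_left x
  have hv : ∀ y, |fderiv ℝ u y e| ≤ K := fun y =>
    ((fderiv ℝ u y).le_of_opNorm_le (hK y) e).trans
      (mul_le_of_le_one_right ((norm_nonneg _).trans (hK y)) he)
  have hvm : Measurable (fun y => fderiv ℝ u y e) := measurable_fderiv_apply_const ℝ u e
  set C1 := 4 * L * (2 * L + 1) + (2 * L + 1) ^ 2 * (n + 1) with hC1
  have key : ∀ δ, 0 < δ → |∫ y, P y ^ 2 * regKer n s δ x y * fderiv ℝ u y e| ≤
      C1 * alphaC n s * (∫ z, domKer n s z) * ψ x ^ 2 := by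
    intro δ hδ
    have hD : ∀ y, ∃ D : Rn n →L[ℝ] ℝ, HasFDerivAt (fun y => P y ^ 2 * regKer n s δ x y) D y ∧
        |D e| ≤ C1 * alphaC n s * ψ x ^ 2 * domKer n s (x - y) := by
      intro y
      obtain ⟨D, hD, hDb⟩ := exists_hasFDerivAt_regKer hs hα hδ x y
      have h1 : HasFDerivAt ψ (fderiv ℝ ψ y) y :=
        (hψ'.differentiable one_ne_zero y).hasFDerivAt
      have h2 := (h1.pow 2).const_sub (ψ x ^ 2)
      have h3 := (hasDerivAt_max_zero_sq (ψ x ^ 2 - ψ y ^ 2)).comp_hasFDerivAt y h2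
      refine ⟨_, h3.mul hD, ?_⟩
      have hψe : |fderiv ℝ ψ y e| ≤ L := by
        have : ‖fderiv ℝ ψ y‖ ≤ L := norm_fderiv_le_of_lip' ℝ hL
          (Eventually.of_forall fun z => hψ.lip z y)
        exact ((fderiv ℝ ψ y).le_of_opNorm_le this e).trans (mul_le_of_le_one_right hL he)
      simp only [_root_.add_apply, _root_.smul_apply, smul_eq_mul, _root_.neg_apply]
      change |P y ^ 2 * D e + regKer n s δ x y *
        (2 * P y * -(2 • ψ y ^ (2 - 1) * fderiv ℝ ψ y e))| ≤ _
      rcases eq_or_ne x y with rfl | hxy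
      · rw [hPx]; simp [domKer]
      have hr0 := regKer_nonneg hα hδ x y
      have hr := regKer_le_fracKer hs hα hδ hxy
      have hm0 : 0 ≤ min ‖x - y‖ 1 := by positivity
      have hψx := hψ.nonneg x
      have hψy := hψ.nonneg y
      have hPy := hP0 y
      have t1 : |P y ^ 2 * D e| ≤
          (2 * L + 1) ^ 2 * ψ x ^ 2 * ((n + 1) * (min ‖x - y‖ 1 * fracKer n s x y)) := by
        rw [abs_mul, abs_of_nonneg (sq_nonneg _)]
        calc P y ^ 2 * |D e| ≤ (2 * L + 1) ^ 2 * ψ x ^ 2 * min ‖x - y‖ 1 ^ 2 * |D e| := by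
              gcongr; exact hPsq y
          _ ≤ (2 * L + 1) ^ 2 * ψ x ^ 2 * (min ‖x - y‖ 1 * ‖x - y‖) * |D e| := by
              rw [sq (min _ _)]; gcongr; exact min_le_left _ _
          _ = (2 * L + 1) ^ 2 * ψ x ^ 2 * (min ‖x - y‖ 1 * (‖x - y‖ * |D e|)) := by ring
          _ ≤ (2 * L + 1) ^ 2 * ψ x ^ 2 * (min ‖x - y‖ 1 * ((n + 1) * fracKer n s x y)) := by
              exact mul_le_mul_of_nonneg_left
                (mul_le_mul_of_nonneg_left (hDb hxy e he) hm0) (by positivity)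
          _ = _ := by ring
      have t2 : |regKer n s δ x y * (2 * P y * -(2 • ψ y ^ (2 - 1) * fderiv ℝ ψ y e))| ≤
          4 * L * (2 * L + 1) * ψ x ^ 2 * (min ‖x - y‖ 1 * fracKer n s x y) := by
        have e1 : regKer n s δ x y * (2 * P y * -(2 • ψ y ^ (2 - 1) * fderiv ℝ ψ y e)) =
            -(4 * regKer n s δ x y * (P y * ψ y) * fderiv ℝ ψ y e) := by
          simp; ring
        rw [e1, abs_neg, abs_mul, abs_of_nonneg (by positivity)]
        calc 4 * regKer n s δ x y * (P y * ψ y) * |fderiv ℝ ψ y e|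
            ≤ 4 * fracKer n s x y * (P y * ψ x) * L := by
              have := hr0.trans hr
              gcongr 4 * ?_ * ?_ * ?_
              exact hPψ y
          _ ≤ 4 * fracKer n s x y * ((2 * L + 1) * ψ x * min ‖x - y‖ 1 * ψ x) * L := by
              have := hr0.trans hr
              gcongr
              exact hPm y
          _ = _ := by ring
      refine (abs_add_le _ _).trans ((add_le_add t1 t2).trans_eq ?_)
      rw [min_mul_fracKer, hC1]; ring
    have hdiff : Differentiable ℝ (fun y => P y ^ 2 * regKer n s δ x y) := fun y => by
      obtain ⟨D, hD, -⟩ := hD y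
      exact hD.differentiableAt
    have hbd : ∀ y, |fderiv ℝ (fun y => P y ^ 2 * regKer n s δ x y) y e| ≤
        C1 * alphaC n s * ψ x ^ 2 * domKer n s (x - y) := fun y => by
      obtain ⟨D, hD, h⟩ := hD y
      rwa [hD.fderiv]
    have hFi : Integrable (fun y => P y ^ 2 * regKer n s δ x y) := by
      refine (hdom.const_mul ((2 * L + 1) ^ 2 * alphaC n s)).mono'
        hdiff.continuous.aestronglyMeasurable (Eventually.of_forall fun y => ?_)
      rw [Real.norm_eq_abs, abs_of_nonneg (mul_nonneg (sq_nonneg _) (regKer_nonneg hα hδ _ _))]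
      exact hFδ δ hδ y
    have hFi' : Integrable (fun y => fderiv ℝ (fun y => P y ^ 2 * regKer n s δ x y) y e) :=
      (hdom.const_mul (C1 * alphaC n s * ψ x ^ 2)).mono'
        (measurable_fderiv_apply_const ℝ _ e).aestronglyMeasurable
        (Eventually.of_forall hbd)
    have hFu' : Integrable
        (fun y => fderiv ℝ (fun y => P y ^ 2 * regKer n s δ x y) y e * u y) :=
      hFi'.mul_bdd (c := 1) hu.continuous.aestronglyMeasurable (Eventually.of_forall hu1)
    rw [integral_mul_fderiv_eq_neg_fderiv_mul_of_integrable (μ := volume) hFu'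
      (hFi.mul_bdd (c := K) hvm.aestronglyMeasurable (Eventually.of_forall hv))
      (hFi.mul_bdd (c := 1) hu.continuous.aestronglyMeasurable (Eventually.of_forall hu1))
      (fun y _ => hdiff y) (fun y _ => hu.differentiable one_ne_zero y), abs_neg]
    refine (abs_integral_le_integral_abs).trans ?_
    calc _ ≤ ∫ y, C1 * alphaC n s * ψ x ^ 2 * domKer n s (x - y) := by
          refine integral_mono hFu'.abs (hdom.const_mul _) fun y => ?_
          simp only [abs_mul]
          exact (mul_le_of_le_one_right (abs_nonneg _) (hu1 y)).trans (hbd y)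
      _ = _ := by
          rw [integral_const_mul, integral_sub_left_eq_self (domKer n s) volume x]; ring
  have hlim : Tendsto (fun δ => ∫ y, P y ^ 2 * regKer n s δ x y * fderiv ℝ u y e) (𝓝[>] 0)
      (𝓝 (∫ y, P y ^ 2 * fracKer n s x y * fderiv ℝ u y e)) := by
    refine tendsto_integral_filter_of_dominated_convergence
      (fun y => (2 * L + 1) ^ 2 * alphaC n s * domKer n s (x - y) * K) ?_ ?_
      ((hdom.const_mul _).mul_const _) ?_
    · refine Eventually.of_forall fun δ => ?_
      have : Measurable (regKer n s δ x) := by unfold regKer; fun_prop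
      exact (((hPc.pow 2).measurable.mul this).mul hvm).aestronglyMeasurable
    · filter_upwards [self_mem_nhdsWithin] with δ hδ
      refine Eventually.of_forall fun y => ?_
      have h0 := mul_nonneg (sq_nonneg (P y)) (regKer_nonneg hα hδ x y)
      rw [Real.norm_eq_abs, abs_mul, abs_of_nonneg h0]
      exact mul_le_mul (hFδ δ hδ y) (hv y) (abs_nonneg _) (h0.trans (hFδ δ hδ y))
    · refine Eventually.of_forall fun y => ?_
      rcases eq_or_ne x y with rfl | hxy
      · simp [hPx]
      · exact ((tendsto_regKer hxy).const_mul _).mul_const _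
  exact le_of_tendsto hlim.abs (by filter_upwards [self_mem_nhdsWithin] with δ hδ using key δ hδ)

lemma IsCutoff.sq {n : ℕ} {L : ℝ} {ψ : Rn n → ℝ} (h : IsCutoff n L ψ) :
    IsCutoff n (2 * L) (fun x => ψ x ^ 2) where
  cont := h.cont.pow 2
  nonneg x := sq_nonneg _
  le_one x := pow_le_one₀ (h.nonneg x) (h.le_one x)
  eq_zero x hx := by simp [h.eq_zero x hx]
  lip_nonneg := by linarith [h.lip_nonneg]
  lip x y := by
    have e : ψ x ^ 2 - ψ y ^ 2 = (ψ x + ψ y) * (ψ x - ψ y) := by ring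
    have h1 : |ψ x + ψ y| ≤ 2 := by
      rw [abs_of_nonneg (add_nonneg (h.nonneg x) (h.nonneg y))]
      linarith [h.le_one x, h.le_one y]
    rw [e, abs_mul, mul_assoc]
    exact mul_le_mul h1 (h.lip x y) (abs_nonneg _) zero_le_two

lemma IsCutoff.hasCompactSupport {n : ℕ} {L : ℝ} {ψ : Rn n → ℝ} (h : IsCutoff n L ψ) :
    HasCompactSupport ψ :=
  HasCompactSupport.intro (isCompact_closedBall _ _) fun x hx => h.eq_zero x hx

lemma exists_isCutoff (n : ℕ) : ∃ (L : ℝ) (ψ : Rn n → ℝ), IsCutoff n L ψ ∧ ContDiff ℝ 1 ψ ∧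
    ∀ x ∈ ball (0 : Rn n) (1 / 4), ψ x = 1 := by
  let f : ContDiffBump (0 : Rn n) := ⟨1 / 4, 1 / 2, by norm_num, by norm_num⟩
  have hf : ContDiff ℝ 1 f := f.contDiff
  obtain ⟨L, hL⟩ := hf.lipschitzWith_of_hasCompactSupport f.hasCompactSupport one_ne_zero
  refine ⟨L, f, ⟨hf.continuous, fun x => f.nonneg, fun x => f.le_one, fun x hx => ?_, L.2,
    fun x y => ?_⟩, hf, fun x hx => f.one_of_mem_closedBall (ball_subset_closedBall hx)⟩
  · refine f.zero_of_le_dist ?_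
    rw [mem_closedBall, not_le] at hx
    exact hx.le
  · simpa [Real.norm_eq_abs] using hL.norm_sub_le x y

/-- The bilinear cutoff error is controlled by the weighted `L¹` norm of the derivative. -/
lemma integral_sq_sub_mul_fderiv_le {n : ℕ} (hn : 1 ≤ n) {s : ℝ}
    (hs : s ∈ Set.Ioo (0 : ℝ) 1) (hα : 0 ≤ alphaC n s) {L : ℝ} {ψ : Rn n → ℝ}
    (hψ : IsCutoff n L ψ) (hψ' : ContDiff ℝ 1 ψ) {u : Rn n → ℝ} (hu : ContDiff ℝ 1 u)
    (hu1 : ∀ x, |u x| ≤ 1) {K : ℝ} (hK : ∀ x, ‖fderiv ℝ u x‖ ≤ K) {e : Rn n} (he : ‖e‖ ≤ 1) :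
    ∫ p : Rn n × Rn n, (ψ p.1 ^ 2 - ψ p.2 ^ 2) ^ 2 * fracKer n s p.1 p.2 *
        (fderiv ℝ u p.1 e * fderiv ℝ u p.2 e) ≤
      2 * ((4 * L * (2 * L + 1) + (2 * L + 1) ^ 2 * (n + 1)) * alphaC n s *
        (∫ z, domKer n s z) * ∫ x, ψ x ^ 2 * |fderiv ℝ u x e|) := by
  set C := (4 * L * (2 * L + 1) + (2 * L + 1) ^ 2 * (n + 1)) * alphaC n s *
    (∫ z, domKer n s z) with hC
  set v : Rn n → ℝ := fun x => fderiv ℝ u x e with hvdef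
  have hvc : Continuous v := (hu.continuous_fderiv one_ne_zero).clm_apply continuous_const
  have hv : ∀ y, |v y| ≤ K := fun y =>
    ((fderiv ℝ u y).le_of_opNorm_le (hK y) e).trans
      (mul_le_of_le_one_right ((norm_nonneg _).trans (hK y)) he)
  have hJi := hψ.sq.integrable_sq_sub_mul hn hs hα hvc hv
  set S : Rn n × Rn n → ℝ := fun p =>
    max (ψ p.1 ^ 2 - ψ p.2 ^ 2) 0 ^ 2 * fracKer n s p.1 p.2 * (v p.1 * v p.2) with hS
  have hSi : Integrable S := by
    have hm : Measurable (fun p : Rn n × Rn n => max (ψ p.1 ^ 2 - ψ p.2 ^ 2) 0 ^ 2) :=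
      (((((hψ.cont.comp continuous_fst).pow 2).sub ((hψ.cont.comp continuous_snd).pow 2)).max
        continuous_const).pow 2).measurable
    refine hJi.mono ((hm.mul (measurable_fracKer n s)).mul
      ((hvc.comp continuous_fst).mul (hvc.comp continuous_snd)).measurable).aestronglyMeasurable
      (Eventually.of_forall fun p => ?_)
    simp only [hS, Real.norm_eq_abs, abs_mul]
    refine mul_le_mul_of_nonneg_right (mul_le_mul_of_nonneg_right ?_ (abs_nonneg _))
      (by positivity)
    rw [abs_of_nonneg (sq_nonneg _), abs_of_nonneg (sq_nonneg _), ← sq_abs (ψ p.1 ^ 2 - ψ p.2 ^ 2)]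
    exact pow_le_pow_left₀ (le_max_right _ _) (max_le (le_abs_self _) (abs_nonneg _)) 2
  have hSi' : Integrable (fun p : Rn n × Rn n => S p.swap) := hSi.swap
  have hpt : (fun p : Rn n × Rn n => (ψ p.1 ^ 2 - ψ p.2 ^ 2) ^ 2 * fracKer n s p.1 p.2 *
        (v p.1 * v p.2)) = fun p => S p + S p.swap := by
    funext p
    have h1 : (ψ p.1 ^ 2 - ψ p.2 ^ 2) ^ 2 = max (ψ p.1 ^ 2 - ψ p.2 ^ 2) 0 ^ 2 +
        max (ψ p.2 ^ 2 - ψ p.1 ^ 2) 0 ^ 2 := by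
      rcases le_total (ψ p.1 ^ 2) (ψ p.2 ^ 2) with h | h
      · rw [max_eq_right (sub_nonpos.2 h), max_eq_left (sub_nonneg.2 h)]; ring
      · rw [max_eq_left (sub_nonneg.2 h), max_eq_right (sub_nonpos.2 h)]; ring
    simp only [hS, Prod.fst_swap, Prod.snd_swap, fracKer_comm n s p.2 p.1]
    rw [h1]; ring
  have hTs : ∫ p : Rn n × Rn n, S p.swap = ∫ p, S p := integral_prod_swap S
  have hwi : Integrable (fun x => ψ x ^ 2 * |v x|) :=
    ((hψ.sq.cont).mul hvc.abs).integrable_of_hasCompactSupport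
      (hψ.sq.hasCompactSupport.mul_right)
  have hle : ∫ p, S p ≤ C * ∫ x, ψ x ^ 2 * |v x| := by
    have h1 : ∫ p, S p = ∫ x, ∫ y, S (x, y) := integral_prod S hSi
    rw [h1, ← integral_const_mul]
    refine (Real.le_norm_self _).trans (norm_integral_le_of_norm_le (hwi.const_mul C)
      (Eventually.of_forall fun x => ?_))
    have h2 : ∫ y, S (x, y) =
        v x * ∫ y, max (ψ x ^ 2 - ψ y ^ 2) 0 ^ 2 * fracKer n s x y * v y := by
      rw [← integral_const_mul]
      refine integral_congr_ae (Eventually.of_forall fun y => ?_)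
      simp only [hS]; ring
    rw [h2, Real.norm_eq_abs, abs_mul]
    have h3 := abs_integral_posPart_mul_fderiv_le hn hs hα hψ hψ' hu hu1 hK he x
    calc _ ≤ |v x| * (C * ψ x ^ 2) := mul_le_mul_of_nonneg_left h3 (abs_nonneg _)
      _ = _ := by ring
  calc _ = ∫ p : Rn n × Rn n, (S p + S p.swap) := by rw [← hpt]
    _ = 2 * ∫ p, S p := by rw [integral_add hSi hSi', hTs]; ring
    _ ≤ _ := mul_le_mul_of_nonneg_left hle zero_le_two

/-- The difference quotient of `u` in the direction `e` with step `h`. -/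
def diffQuot {n : ℕ} (u : Rn n → ℝ) (e : Rn n) (h : ℝ) (x : Rn n) : ℝ :=
  h⁻¹ * (u (x + h • e) - u x)

lemma abs_diffQuot_le {n : ℕ} {u : Rn n → ℝ} {K : ℝ} (hK : ∀ x y, |u x - u y| ≤ K * ‖x - y‖)
    (hK0 : 0 ≤ K) {e : Rn n} (he : ‖e‖ ≤ 1) {h : ℝ} (h0 : 0 < h) (x : Rn n) :
    |diffQuot u e h x| ≤ K := by
  rw [diffQuot, abs_mul, abs_of_pos (inv_pos.2 h0), inv_mul_le_iff₀ h0, mul_comm h]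
  refine (hK _ _).trans (mul_le_mul_of_nonneg_left ?_ hK0)
  rw [add_sub_cancel_left, norm_smul, Real.norm_eq_abs, abs_of_pos h0]
  exact mul_le_of_le_one_right h0.le he

/-- The zeroth order coefficient of the equation satisfied by a difference quotient. -/
def diffCoeff {n : ℕ} (s ε : ℝ) (u : Rn n → ℝ) (e : Rn n) (h : ℝ) (x : Rn n) : ℝ :=
  ε ^ (-s) * (u (x + h • e) ^ 2 + u (x + h • e) * u x + u x ^ 2 - 1)

lemma integral_diffQuot_eq {n : ℕ} (hn : 1 ≤ n) {s ε : ℝ} (hs : s ∈ Set.Ioo (0 : ℝ) 1)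
    (hα : 0 ≤ alphaC n s) {u : Rn n → ℝ} (hu : Continuous u) (hu1 : ∀ x, |u x| ≤ 1) {K : ℝ}
    (hK0 : 0 ≤ K) (hK : ∀ x y, |u x - u y| ≤ K * ‖x - y‖)
    (hsol : IsACSol n s ε u (ball 0 1)) {e : Rn n} (he : ‖e‖ ≤ 1) {h : ℝ} (h0 : 0 < h)
    (h1 : h < 1 / 2) {x : Rn n} (hx : x ∈ closedBall (0 : Rn n) (1 / 2)) :
    ∫ y, (diffQuot u e h x - diffQuot u e h y) * fracKer n s x y =
      -(diffCoeff s ε u e h x * diffQuot u e h x) := by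
  have hx' : ‖x‖ ≤ 1 / 2 := by simpa using hx
  have hhe : ‖h • e‖ < 1 / 2 := by
    rw [norm_smul, Real.norm_eq_abs, abs_of_pos h0]
    exact (mul_le_of_le_one_right h0.le he).trans_lt h1
  have e1 := hsol x (by simp; linarith)
  have e2 := hsol (x + h • e) (by simp; linarith [norm_add_le x (h • e)])
  have i1 := integrable_sub_mul_fracKer hn hs hα hu hu1 hK hK0 x
  have i2' := integrable_sub_mul_fracKer hn hs hα hu hu1 hK hK0 (x + h • e)
  have i2 : Integrable (fun y => (u (x + h • e) - u (y + h • e)) * fracKer n s x y) := by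
    have := i2'.comp_add_right (h • e)
    simpa only [fracKer_add_right] using this
  have e3 : ∫ y, (u (x + h • e) - u (y + h • e)) * fracKer n s x y =
      ∫ y, (u (x + h • e) - u y) * fracKer n s (x + h • e) y := by
    have := integral_add_right_eq_self (μ := volume)
      (fun y => (u (x + h • e) - u y) * fracKer n s (x + h • e) y) (h • e)
    simpa only [fracKer_add_right] using this
  have e4 : ∫ y, (diffQuot u e h x - diffQuot u e h y) * fracKer n s x y =
      h⁻¹ * ((∫ y, (u (x + h • e) - u (y + h • e)) * fracKer n s x y) -
        ∫ y, (u x - u y) * fracKer n s x y) := by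
    rw [← integral_sub i2 i1, ← integral_const_mul]
    refine integral_congr_ae (Eventually.of_forall fun y => ?_)
    simp only [diffQuot]; ring
  rw [e4, e3, eq_neg_of_add_eq_zero_left e1, eq_neg_of_add_eq_zero_left e2]
  simp only [diffQuot, diffCoeff]; ring

lemma Qform_eq_integral {n : ℕ} {s ε : ℝ} {u ξ : Rn n → ℝ}
    (h0 : ∀ x, x ∉ closedBall (0 : Rn n) (1 / 2) → ξ x = 0) :
    Qform n s ε u (ball 0 1) ξ =
      (1 / 4) * (∫ p : Rn n × Rn n, (ξ p.1 - ξ p.2) ^ 2 * fracKer n s p.1 p.2) +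
        ε ^ (-s) * ∫ x, (3 * u x ^ 2 - 1) * ξ x ^ 2 := by
  have h1 : ∀ x, x ∉ ball (0 : Rn n) 1 → ξ x = 0 := fun x hx =>
    h0 x fun h => hx (closedBall_subset_ball (by norm_num) h)
  unfold Qform
  rw [setIntegral_eq_integral_of_forall_compl_eq_zero (s := ball (0 : Rn n) 1),
    setIntegral_eq_integral_of_forall_compl_eq_zero]
  · intro p hp
    rw [mem_compl_iff, not_not] at hp
    simp [h1 _ hp.1, h1 _ hp.2]
  · intro x hx
    simp [h1 x hx]

/-- The stability inequality tested with a localized difference quotient. -/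
lemma AlmostStable.diffQuot_ineq {n : ℕ} (hn : 1 ≤ n) {s ε : ℝ} (hs : s ∈ Set.Ioo (0 : ℝ) 1)
    (hε : 0 < ε) (hα : 0 ≤ alphaC n s) {L : ℝ} {η : Rn n → ℝ} (hη : IsCutoff n L η)
    (hη' : ContDiff ℝ 1 η) {u : Rn n → ℝ} (hu : ContDiff ℝ 1 u) (hu1 : ∀ x, |u x| ≤ 1) {K : ℝ}
    (hK : ∀ x y, |u x - u y| ≤ K * ‖x - y‖) (hK0 : 0 ≤ K)
    (hsol : IsACSol n s ε u (ball 0 1)) {Λ : ℝ}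
    (hΛ : Λ ≤ alphaC n s * (3 : ℝ) ^ (-((n : ℝ) + 1)) / 8)
    (hst : AlmostStable n s ε Λ u (ball 0 1))
    {e : Rn n} (he : ‖e‖ ≤ 1) {h : ℝ} (h0 : 0 < h) (h1 : h < 1 / 2) :
    alphaC n s * (3 : ℝ) ^ (-((n : ℝ) + 1)) / 8 * (∫ x, η x * |diffQuot u e h x|) ^ 2 ≤
      1 / 2 * (∫ p : Rn n × Rn n, (η p.1 - η p.2) ^ 2 * fracKer n s p.1 p.2 *
        (diffQuot u e h p.1 * diffQuot u e h p.2)) +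
      ε ^ (-s) * (3 * K) * K ^ 2 * volume.real (closedBall (0 : Rn n) (1 / 2)) * h := by
  set w := diffQuot u e h with hw
  set b := diffCoeff s ε u e h with hb
  set κ := alphaC n s * (3 : ℝ) ^ (-((n : ℝ) + 1)) with hκ
  have hεs : 0 < ε ^ (-s) := Real.rpow_pos_of_pos hε _
  have hstep : ∀ x, |u (x + h • e) - u x| ≤ K * h := fun x => by
    refine (hK _ _).trans (mul_le_mul_of_nonneg_left ?_ hK0)
    rw [add_sub_cancel_left, norm_smul, Real.norm_eq_abs, abs_of_pos h0]
    exact mul_le_of_le_one_right h0.le he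
  have hus : ContDiff ℝ 1 (fun x => u (x + h • e)) := hu.comp (contDiff_id.add contDiff_const)
  have hwd : ContDiff ℝ 1 w := contDiff_const.mul (hus.sub hu)
  have hwM : ∀ x, |w x| ≤ K := abs_diffQuot_le hK hK0 he h0
  have hwN : ∀ x y, |w x - w y| ≤ (h⁻¹ * (2 * K)) * ‖x - y‖ := fun x y => by
    have e1 : w x - w y = h⁻¹ * ((u (x + h • e) - u (y + h • e)) - (u x - u y)) := by
      simp only [hw, diffQuot]; ring
    have e2 := hK (x + h • e) (y + h • e)
    rw [add_sub_add_right_eq_sub] at e2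
    rw [e1, abs_mul, abs_of_pos (inv_pos.2 h0), mul_assoc]
    refine mul_le_mul_of_nonneg_left ?_ (inv_pos.2 h0).le
    refine (abs_sub _ _).trans ?_
    linarith [hK x y]
  obtain ⟨hAi, hA⟩ := hη.integral_sq_sub_mul_eq hn hs hα hwd.continuous (b := b) hwM hwN
    (by positivity) fun x hx =>
      integral_diffQuot_eq hn hs hα hu.continuous hu1 hK0 hK hsol he h0 h1 hx
  set ξ : Rn n → ℝ := fun x => η x * w x with hξ
  have hξ0 : ∀ x, x ∉ closedBall (0 : Rn n) (1 / 2) → ξ x = 0 := fun x hx => by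
    simp [hξ, hη.eq_zero x hx]
  have hξd : ContDiff ℝ 1 ξ := hη'.mul hwd
  have hξc : HasCompactSupport ξ := hη.hasCompactSupport.mul_right
  have hadm : IsCc1On n (ball 0 1) ξ := by
    refine ⟨hξd, hξc, (closure_minimal ?_ isClosed_closedBall).trans
      (closedBall_subset_ball (by norm_num : (1 / 2 : ℝ) < 1))⟩
    intro x hx
    by_contra hx'
    exact hx (hξ0 x hx')
  have hQ := hst ξ hadm
  rw [Qform_eq_integral hξ0, setIntegral_eq_integral_of_forall_compl_eq_zero (fun x hx => by
    rw [hξ0 x fun h => hx (closedBall_subset_ball (by norm_num) h), abs_zero])] at hQ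
  have hP := sq_integral_abs_le_seminorm hn hs hα hξd.continuous hξ0 hAi
  have hS : ∫ x, |ξ x| = ∫ x, η x * |w x| := by
    simp only [hξ, abs_mul, abs_of_nonneg (hη.nonneg _)]
  have hbc : Continuous b := by
    simp only [hb]
    exact continuous_const.mul ((((hus.continuous.pow 2).add
      (hus.continuous.mul hu.continuous)).add (hu.continuous.pow 2)).sub continuous_const)
  have hcξ2 : HasCompactSupport (fun x => ξ x ^ 2) :=
    hξc.comp_left (g := fun t : ℝ => t ^ 2) (by norm_num)
  have ib : Integrable (fun x => b x * ξ x ^ 2) :=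
    (hbc.mul (hξd.continuous.pow 2)).integrable_of_hasCompactSupport hcξ2.mul_left
  have ic : Integrable (fun x => ε ^ (-s) * ((3 * u x ^ 2 - 1) * ξ x ^ 2)) :=
    ((((continuous_const.mul (hu.continuous.pow 2)).sub continuous_const).mul
      (hξd.continuous.pow 2)).integrable_of_hasCompactSupport hcξ2.mul_left).const_mul _
  have hR : ε ^ (-s) * (∫ x, (3 * u x ^ 2 - 1) * ξ x ^ 2) - ∫ x, b x * ξ x ^ 2 ≤
      ε ^ (-s) * (3 * K) * K ^ 2 * volume.real (closedBall (0 : Rn n) (1 / 2)) * h := by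
    rw [← integral_const_mul, ← integral_sub ic ib,
      ← setIntegral_eq_integral_of_forall_compl_eq_zero (s := closedBall (0 : Rn n) (1 / 2))
        (fun x hx => by rw [hξ0 x hx]; ring)]
    have := norm_setIntegral_le_of_norm_le_const (μ := volume)
      (s := closedBall (0 : Rn n) (1 / 2)) (C := ε ^ (-s) * (3 * K * h) * K ^ 2)
      (f := fun x => ε ^ (-s) * ((3 * u x ^ 2 - 1) * ξ x ^ 2) - b x * ξ x ^ 2)
      measure_closedBall_lt_top (fun x _ => by
        have e1 : ε ^ (-s) * ((3 * u x ^ 2 - 1) * ξ x ^ 2) - b x * ξ x ^ 2 =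
            ε ^ (-s) * (-(u (x + h • e) + 2 * u x) * (u (x + h • e) - u x)) * ξ x ^ 2 := by
          simp only [hb, diffCoeff]; ring
        have e2 : |u (x + h • e) + 2 * u x| ≤ 3 := by
          refine (abs_add_le _ _).trans ?_
          rw [abs_mul, abs_two]
          linarith [hu1 x, hu1 (x + h • e)]
        have e3 : ξ x ^ 2 ≤ K ^ 2 := by
          rw [← sq_abs]
          refine pow_le_pow_left₀ (abs_nonneg _) ?_ 2
          rw [hξ, abs_mul]
          exact (mul_le_of_le_one_left (abs_nonneg _) (hη.abs_le_one x)).trans (hwM x)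
        rw [e1, Real.norm_eq_abs, abs_mul, abs_mul, abs_mul, abs_neg, abs_of_pos hεs,
          abs_of_nonneg (sq_nonneg (ξ x))]
        refine mul_le_mul (mul_le_mul_of_nonneg_left ?_ hεs.le) e3 (sq_nonneg _) (by positivity)
        calc _ ≤ 3 * (K * h) := mul_le_mul e2 (hstep x) (abs_nonneg _) (by norm_num)
          _ = _ := by ring)
    refine (le_abs_self _).trans (this.trans_eq ?_)
    ring
  have hΛS : Λ * (∫ x, |ξ x|) ^ 2 ≤ κ / 8 * (∫ x, |ξ x|) ^ 2 :=
    mul_le_mul_of_nonneg_right hΛ (sq_nonneg _)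
  rw [← hS]
  linarith

lemma tendsto_diffQuot {n : ℕ} {u : Rn n → ℝ} (hu : ContDiff ℝ 1 u) (e x : Rn n) :
    Tendsto (fun h => diffQuot u e h x) (𝓝[>] 0) (𝓝 (fderiv ℝ u x e)) := by
  have h := ((hu.differentiable one_ne_zero x).hasFDerivAt.hasLineDerivAt e).tendsto_slope_zero_right
  simpa [diffQuot] using h

/-- The stability inequality for a localized directional derivative. -/
lemma AlmostStable.fderiv_ineq {n : ℕ} (hn : 1 ≤ n) {s ε : ℝ} (hs : s ∈ Set.Ioo (0 : ℝ) 1)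
    (hε : 0 < ε) (hα : 0 ≤ alphaC n s) {L : ℝ} {η : Rn n → ℝ} (hη : IsCutoff n L η)
    (hη' : ContDiff ℝ 1 η) {u : Rn n → ℝ} (hu : ContDiff ℝ 1 u) (hu1 : ∀ x, |u x| ≤ 1) {K : ℝ}
    (hK : ∀ x y, |u x - u y| ≤ K * ‖x - y‖) (hK0 : 0 ≤ K)
    (hsol : IsACSol n s ε u (ball 0 1)) {Λ : ℝ}
    (hΛ : Λ ≤ alphaC n s * (3 : ℝ) ^ (-((n : ℝ) + 1)) / 8)
    (hst : AlmostStable n s ε Λ u (ball 0 1)) {e : Rn n} (he : ‖e‖ ≤ 1) :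
    alphaC n s * (3 : ℝ) ^ (-((n : ℝ) + 1)) / 8 * (∫ x, η x * |fderiv ℝ u x e|) ^ 2 ≤
      1 / 2 * (∫ p : Rn n × Rn n, (η p.1 - η p.2) ^ 2 * fracKer n s p.1 p.2 *
        (fderiv ℝ u p.1 e * fderiv ℝ u p.2 e)) := by
  have hdc : ∀ h, Continuous (diffQuot u e h) := fun h =>
    continuous_const.mul ((hu.continuous.comp (continuous_id.add continuous_const)).sub
      hu.continuous)
  have hpos : ∀ᶠ h : ℝ in 𝓝[>] 0, 0 < h := eventually_mem_nhdsWithin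
  have hsmall : ∀ᶠ h : ℝ in 𝓝[>] 0, h < 1 / 2 :=
    mem_nhdsWithin_of_mem_nhds (gt_mem_nhds (by norm_num))
  have t1 : Tendsto (fun h => ∫ x, η x * |diffQuot u e h x|) (𝓝[>] 0)
      (𝓝 (∫ x, η x * |fderiv ℝ u x e|)) := by
    refine tendsto_integral_filter_of_dominated_convergence (fun x => η x * K)
      (Eventually.of_forall fun h => (hη.cont.mul (hdc h).abs).aestronglyMeasurable) ?_
      ((hη.cont.integrable_of_hasCompactSupport hη.hasCompactSupport).mul_const K)
      (Eventually.of_forall fun x => ((tendsto_diffQuot hu e x).abs).const_mul _)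
    filter_upwards [hpos] with h h0
    refine Eventually.of_forall fun x => ?_
    rw [Real.norm_eq_abs, abs_mul, abs_abs, abs_of_nonneg (hη.nonneg x)]
    exact mul_le_mul_of_nonneg_left (abs_diffQuot_le hK hK0 he h0 x) (hη.nonneg x)
  have t2 : Tendsto (fun h => ∫ p : Rn n × Rn n, (η p.1 - η p.2) ^ 2 * fracKer n s p.1 p.2 *
      (diffQuot u e h p.1 * diffQuot u e h p.2)) (𝓝[>] 0)
      (𝓝 (∫ p : Rn n × Rn n, (η p.1 - η p.2) ^ 2 * fracKer n s p.1 p.2 *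
        (fderiv ℝ u p.1 e * fderiv ℝ u p.2 e))) := by
    have hi := hη.integrable_sq_sub hn hs hα
    refine tendsto_integral_filter_of_dominated_convergence
      (fun p : Rn n × Rn n => (η p.1 - η p.2) ^ 2 * fracKer n s p.1 p.2 * (K * K))
      (Eventually.of_forall fun h => hi.aestronglyMeasurable.mul
        (((hdc h).comp continuous_fst).mul ((hdc h).comp continuous_snd)).aestronglyMeasurable) ?_
      (hi.mul_const _)
      (Eventually.of_forall fun p => ((tendsto_diffQuot hu e p.1).mul
        (tendsto_diffQuot hu e p.2)).const_mul _)
    filter_upwards [hpos] with h h0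
    refine Eventually.of_forall fun p => ?_
    have hnn : 0 ≤ (η p.1 - η p.2) ^ 2 * fracKer n s p.1 p.2 :=
      mul_nonneg (sq_nonneg _) (fracKer_nonneg hα _ _)
    rw [Real.norm_eq_abs, abs_mul, abs_of_nonneg hnn, abs_mul]
    exact mul_le_mul_of_nonneg_left (mul_le_mul (abs_diffQuot_le hK hK0 he h0 _)
      (abs_diffQuot_le hK hK0 he h0 _) (abs_nonneg _) hK0) hnn
  have t3 : Tendsto (fun h : ℝ => ε ^ (-s) * (3 * K) * K ^ 2 *
      volume.real (closedBall (0 : Rn n) (1 / 2)) * h) (𝓝[>] 0) (𝓝 0) := by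
    have : Tendsto (fun h : ℝ => h) (𝓝[>] 0) (𝓝 0) := nhdsWithin_le_nhds
    simpa using this.const_mul (ε ^ (-s) * (3 * K) * K ^ 2 *
      volume.real (closedBall (0 : Rn n) (1 / 2)))
  have t4 := (t2.const_mul (1 / 2)).add t3
  rw [add_zero] at t4
  refine le_of_tendsto_of_tendsto ((t1.pow 2).const_mul _) t4 ?_
  filter_upwards [hpos, hsmall] with h h0 h1
  exact hst.diffQuot_ineq hn hs hε hα hη hη' hu hu1 hK hK0 hsol hΛ he h0 h1

/-- Weighted `L¹` bound for a directional derivative of an almost stable solution. -/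
lemma AlmostStable.integral_abs_fderiv_le {n : ℕ} (hn : 1 ≤ n) {s ε : ℝ}
    (hs : s ∈ Set.Ioo (0 : ℝ) 1) (hε : 0 < ε) (hα : 0 < alphaC n s) {L : ℝ} {ψ : Rn n → ℝ}
    (hψ : IsCutoff n L ψ) (hψ' : ContDiff ℝ 1 ψ) {u : Rn n → ℝ} (hu : ContDiff ℝ 1 u)
    (hu1 : ∀ x, |u x| ≤ 1) {K : ℝ} (hK : ∀ x, ‖fderiv ℝ u x‖ ≤ K)
    (hsol : IsACSol n s ε u (ball 0 1)) {Λ : ℝ}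
    (hΛ : Λ ≤ alphaC n s * (3 : ℝ) ^ (-((n : ℝ) + 1)) / 8)
    (hst : AlmostStable n s ε Λ u (ball 0 1)) {e : Rn n} (he : ‖e‖ ≤ 1) :
    ∫ x, ψ x ^ 2 * |fderiv ℝ u x e| ≤
      8 * (4 * L * (2 * L + 1) + (2 * L + 1) ^ 2 * (n + 1)) / (3 : ℝ) ^ (-((n : ℝ) + 1)) *
        ∫ z, domKer n s z := by
  have hK0 : 0 ≤ K := (norm_nonneg _).trans (hK 0)
  have hKl : ∀ x y, |u x - u y| ≤ K * ‖x - y‖ := fun x y =>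
    Convex.norm_image_sub_le_of_norm_fderiv_le (𝕜 := ℝ) (s := Set.univ)
      (fun z _ => hu.differentiable one_ne_zero z) (fun z _ => hK z) convex_univ
      (Set.mem_univ y) (Set.mem_univ x)
  have h1 := hst.fderiv_ineq hn hs hε hα.le hψ.sq (hψ'.pow 2) hu hu1 hKl hK0 hsol hΛ he
  have h2 := integral_sq_sub_mul_fderiv_le hn hs hα.le hψ hψ' hu hu1 hK he
  have hL := hψ.lip_nonneg
  have hI : 0 ≤ ∫ z, domKer n s z := integral_nonneg fun z => domKer_nonneg n s z
  set κ : ℝ := (3 : ℝ) ^ (-((n : ℝ) + 1))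
  have hκ : 0 < κ := Real.rpow_pos_of_pos (by norm_num) _
  set S := ∫ x, ψ x ^ 2 * |fderiv ℝ u x e|
  set I := ∫ z, domKer n s z
  set C : ℝ := 4 * L * (2 * L + 1) + (2 * L + 1) ^ 2 * (n + 1) with hC
  have hC0 : 0 ≤ C := by positivity
  have hS : 0 ≤ S := integral_nonneg fun x => mul_nonneg (sq_nonneg _) (abs_nonneg _)
  rcases hS.eq_or_lt with h | h
  · rw [← h]; positivity
  have h3 : alphaC n s * S * (κ * S) ≤ alphaC n s * S * (8 * C * I) := by linarith
  have h4 := le_of_mul_le_mul_left h3 (mul_pos hα h)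
  rw [div_mul_eq_mul_div, le_div_iff₀ hκ]
  linarith

lemma norm_le_sum_abs_single {n : ℕ} (f : Rn n →L[ℝ] ℝ) :
    ‖f‖ ≤ ∑ i, |f (EuclideanSpace.single i 1)| := by
  refine f.opNorm_le_bound (Finset.sum_nonneg fun i _ => abs_nonneg _) fun x => ?_
  have hx : f x = ∑ i, x i * f (EuclideanSpace.single i 1) := by
    conv_lhs => rw [← (EuclideanSpace.basisFun (Fin n) ℝ).sum_repr x]
    simp [map_sum]
  rw [hx, Finset.sum_mul]
  refine (Finset.abs_sum_le_sum_abs _ _).trans (Finset.sum_le_sum fun i _ => ?_)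
  rw [abs_mul, mul_comm]
  exact mul_le_mul_of_nonneg_left (PiLp.norm_apply_le x i) (abs_nonneg _)

/-- **BV estimate for almost stable solutions of fractional Allen–Cahn**
(Proposition 3.16 of the paper, Euclidean version): there exist `Λ₀, C > 0` depending only
on `n, s₀` such that any `Λ`-almost stable solution in `B₁` with `Λ ≤ Λ₀` satisfies
`∫_{B_{1/4}} |∇u| ≤ C/(1-s)`, uniformly in `ε`. -/
theorem bv_estimate_almost_stable
    (n : ℕ) (hn : 1 ≤ n) (s₀ : ℝ) (hs₀ : s₀ ∈ Set.Ioo (0 : ℝ) 1) :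
    ∃ Λ₀ C : ℝ, 0 < Λ₀ ∧ 0 < C ∧
    ∀ s : ℝ, s ∈ Set.Ioo s₀ 1 → ∀ ε : ℝ, 0 < ε →
    ∀ u : Rn n → ℝ, (∀ x, u x ∈ Set.Ioo (-1 : ℝ) 1) → ContDiff ℝ 1 u →
      (∃ K : ℝ, ∀ x, ‖fderiv ℝ u x‖ ≤ K) →
      IsACSol n s ε u (Metric.ball 0 1) →
      ∀ Λ : ℝ, Λ ≤ Λ₀ → AlmostStable n s ε Λ u (Metric.ball 0 1) →
      (∫ x in Metric.ball (0 : Rn n) (1 / 4), ‖fderiv ℝ u x‖) ≤ C / (1 - s) := by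
  obtain ⟨a, ha, hα⟩ := exists_alphaC_lower_bound n hn s₀ hs₀
  obtain ⟨L, ψ, hψ, hψ', hψ1⟩ := exists_isCutoff n
  have hL := hψ.lip_nonneg
  set κ : ℝ := (3 : ℝ) ^ (-((n : ℝ) + 1)) with hκdef
  have hκ : 0 < κ := Real.rpow_pos_of_pos (by norm_num) _
  set C₁ : ℝ := 8 * (4 * L * (2 * L + 1) + (2 * L + 1) ^ 2 * (n + 1)) / κ with hC₁
  have hC₁0 : 0 ≤ C₁ := by positivity
  set V : ℝ := n * volume.real (ball (0 : Rn n) 1) with hV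
  have hV0 : 0 ≤ V := by positivity
  have hs₀' : 0 < s₀ := hs₀.1
  refine ⟨a * κ / 8, n * (C₁ * (V * (1 + 1 / s₀))) + 1, by positivity, by positivity, ?_⟩
  intro s hs ε hε u hu1 hu ⟨K, hK⟩ hsol Λ hΛ hst
  have hs' : s ∈ Set.Ioo (0 : ℝ) 1 := ⟨hs₀'.trans hs.1, hs.2⟩
  have h1s : 0 < 1 - s := sub_pos.2 hs.2
  have hαa := hα s hs
  have hα0 : 0 < alphaC n s := ha.trans_le hαa
  have hΛ' : Λ ≤ alphaC n s * κ / 8 := hΛ.trans (by gcongr)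
  have hu1' : ∀ x, |u x| ≤ 1 := fun x => abs_le.2 ⟨(hu1 x).1.le, (hu1 x).2.le⟩
  have hI : ∫ z, domKer n s z ≤ V * (1 + 1 / s₀) / (1 - s) := by
    refine (integrable_domKer_and_integral_le n hn s hs').2.trans ?_
    rw [mul_div_assoc]
    refine mul_le_mul_of_nonneg_left ?_ hV0
    rw [add_div]
    refine add_le_add le_rfl ?_
    calc 1 / s ≤ 1 / s₀ := one_div_le_one_div_of_le hs₀' hs.1.le
      _ ≤ 1 / s₀ / (1 - s) := le_div_self (by positivity) h1s (by linarith [hs'.1])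
  have hdir : ∀ i : Fin n, ∫ x, ψ x ^ 2 * |fderiv ℝ u x (EuclideanSpace.single i 1)| ≤
      C₁ * (V * (1 + 1 / s₀)) / (1 - s) := fun i => by
    refine (hst.integral_abs_fderiv_le hn hs' hε hα0 hψ hψ' hu hu1' hK hsol hΛ'
      (e := EuclideanSpace.single i 1) (by simp)).trans ?_
    rw [mul_div_assoc C₁]
    exact mul_le_mul_of_nonneg_left hI hC₁0
  have hint : ∀ i : Fin n, Integrable
      (fun x => ψ x ^ 2 * |fderiv ℝ u x (EuclideanSpace.single i 1)|) := fun i =>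
    (hψ.sq.cont.mul ((hu.continuous_fderiv one_ne_zero).clm_apply
      continuous_const).abs).integrable_of_hasCompactSupport hψ.sq.hasCompactSupport.mul_right
  have hfc : Continuous (fun x => ‖fderiv ℝ u x‖) := (hu.continuous_fderiv one_ne_zero).norm
  have hnn : ∀ x, 0 ≤ ∑ i : Fin n, ψ x ^ 2 * |fderiv ℝ u x (EuclideanSpace.single i 1)| :=
    fun x => Finset.sum_nonneg fun i _ => mul_nonneg (sq_nonneg _) (abs_nonneg _)
  have hsum := integrable_finsetSum Finset.univ fun i _ => hint i
  calc (∫ x in ball (0 : Rn n) (1 / 4), ‖fderiv ℝ u x‖)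
      ≤ ∫ x in ball (0 : Rn n) (1 / 4),
          ∑ i : Fin n, ψ x ^ 2 * |fderiv ℝ u x (EuclideanSpace.single i 1)| := by
        refine setIntegral_mono_on ((hfc.continuousOn.integrableOn_compact
          (isCompact_closedBall 0 (1 / 4))).mono_set ball_subset_closedBall)
          hsum.integrableOn measurableSet_ball fun x hx => ?_
        simpa [hψ1 x hx] using norm_le_sum_abs_single (fderiv ℝ u x)
    _ ≤ ∫ x, ∑ i : Fin n, ψ x ^ 2 * |fderiv ℝ u x (EuclideanSpace.single i 1)| :=
        setIntegral_le_integral hsum (Eventually.of_forall hnn)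
    _ = ∑ i : Fin n, ∫ x, ψ x ^ 2 * |fderiv ℝ u x (EuclideanSpace.single i 1)| :=
        integral_finsetSum _ fun i _ => hint i
    _ ≤ ∑ _i : Fin n, C₁ * (V * (1 + 1 / s₀)) / (1 - s) := Finset.sum_le_sum fun i _ => hdir i
    _ = n * (C₁ * (V * (1 + 1 / s₀))) / (1 - s) := by
        rw [Finset.sum_const, Finset.card_univ, Fintype.card_fin, nsmul_eq_mul, mul_div_assoc (n : ℝ)]
    _ ≤ _ := by gcongr; linarith

end
end
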